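/- For every n ∈ ℕ and every Π^{0,0^{(n)}}_1 set Pₙ ⊆ ℕ^ℕ there exist a Π⁰₁ set P₀ ⊆ ℕ^ℕ and a homeomorphism H: Pₙ → P₀ such that Xₙ ⊕ 0^{(n)} ≡_T H(Xₙ) ⊕ 0^{(n)} ≡_T H(Xₙ)^{(n)} uniformly for all Xₙ ∈ Pₙ. -/

import Mathlib

namespace Harrington

open scoped Classical

/-- Codes for oracle Turing machines (partial recursive functionals),
    extending `Nat.Partrec.Code` with an `oracle` constructor. -/
inductive OCode : Type
  | zero : OCode
  | succ : OCode
  | left : OCode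
  | right : OCode
  | oracle : OCode
  | pair : OCode → OCode → OCode
  | comp : OCode → OCode → OCode
  | prec : OCode → OCode → OCode
  | rfind' : OCode → OCode

/-- Evaluation of an oracle code relative to a (total) oracle `A`. -/
def evalo (A : ℕ → ℕ) : OCode → ℕ →. ℕ
  | OCode.zero => pure 0
  | OCode.succ => fun n => Part.some (n + 1)
  | OCode.left => fun n => Part.some (Nat.unpair n).1
  | OCode.right => fun n => Part.some (Nat.unpair n).2
  | OCode.oracle => fun n => Part.some (A n)
  | OCode.pair cf cg => fun n => Nat.pair <$> evalo A cf n <*> evalo A cg n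
  | OCode.comp cf cg => fun n => evalo A cg n >>= evalo A cf
  | OCode.prec cf cg =>
    Nat.unpaired fun a n =>
      n.rec (evalo A cf a) fun y IH => do
        let i ← IH
        evalo A cg (Nat.pair a (Nat.pair y i))
  | OCode.rfind' cf =>
    Nat.unpaired fun a m =>
      (Nat.rfind fun n => (fun x => x = 0) <$> evalo A cf (Nat.pair a (n + m))).map (· + m)

/-- The standard enumeration of oracle codes: `OCode.ofNat e` is the `e`-th oracle machine. -/
def OCode.ofNat : ℕ → OCode
  | 0 => OCode.zero
  | 1 => OCode.succ
  | 2 => OCode.left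
  | 3 => OCode.right
  | 4 => OCode.oracle
  | n + 5 =>
    have hm : n.div2.div2 < n + 5 := by
      have h1 : n.div2.div2 ≤ n := by
        simp only [Nat.div2_val]
        exact le_trans (Nat.div_le_self _ _) (Nat.div_le_self _ _)
      omega
    have _m1 : n.div2.div2.unpair.1 < n + 5 := lt_of_le_of_lt (Nat.unpair_left_le _) hm
    have _m2 : n.div2.div2.unpair.2 < n + 5 := lt_of_le_of_lt (Nat.unpair_right_le _) hm
    match n.bodd, n.div2.bodd with
    | false, false => OCode.pair (OCode.ofNat n.div2.div2.unpair.1) (OCode.ofNat n.div2.div2.unpair.2)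
    | false, true  => OCode.comp (OCode.ofNat n.div2.div2.unpair.1) (OCode.ofNat n.div2.div2.unpair.2)
    | true,  false => OCode.prec (OCode.ofNat n.div2.div2.unpair.1) (OCode.ofNat n.div2.div2.unpair.2)
    | true,  true  => OCode.rfind' (OCode.ofNat n.div2.div2)

/-- The Turing jump `A'` of an oracle `A`:  `A'(e) = 1` if the `e`-th machine with
    oracle `A` halts on input `e`, and `A'(e) = 0` otherwise. -/
noncomputable def jump (A : ℕ → ℕ) : ℕ → ℕ :=
  fun e => if (evalo A (OCode.ofNat e) e).Dom then 1 else 0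

/-- Iterated Turing jump `A^{(n)}`. -/
noncomputable def jumpIter (A : ℕ → ℕ) : ℕ → (ℕ → ℕ)
  | 0 => A
  | n + 1 => jump (jumpIter A n)

/-- The constant zero function (the trivial oracle `0`). -/
def zeroF : ℕ → ℕ := fun _ => 0

/-- The `ω`-jump: `X^{(ω)} = {(i,n) : i ∈ X^{(n)}}`, coded via `Nat.pair` and identified
    with its characteristic function. -/
noncomputable def omegaJump (A : ℕ → ℕ) : ℕ → ℕ :=
  fun m => if jumpIter A m.unpair.2 m.unpair.1 ≠ 0 then 1 else 0

/-- The recursive join `A ⊕ B`. -/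
def oplus (A B : ℕ → ℕ) : ℕ → ℕ :=
  fun n => if n % 2 = 0 then A (n / 2) else B (n / 2)

/-- Code `c` computes the total function `f` from oracle `A`. -/
def computesFn (A : ℕ → ℕ) (c : OCode) (f : ℕ → ℕ) : Prop :=
  ∀ n, evalo A c n = Part.some (f n)

/-- Turing reducibility `X ≤_T A` for points of Baire space. -/
def TRedIn (X A : ℕ → ℕ) : Prop := ∃ c : OCode, computesFn A c X

/-- `X` is arithmetical relative to `Y`: `X ≤_T Y^{(n)}` for some `n`. -/
def ArithIn (X Y : ℕ → ℕ) : Prop := ∃ n : ℕ, TRedIn X (jumpIter Y n)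

/-- `X` and `Y` are arithmetically equivalent. -/
def ArithEquiv (X Y : ℕ → ℕ) : Prop := ArithIn X Y ∧ ArithIn Y X

/-! ### Strings and trees -/

/-- Strings: finite sequences of natural numbers. -/
abbrev Str := List ℕ

/-- The initial segment `X↾n` of a point `X` of Baire space. -/
def initSeg (X : ℕ → ℕ) (n : ℕ) : Str := (List.range n).map X

/-- A tree is a set of strings closed under initial segments. -/
def IsTree (T : Set Str) : Prop := ∀ σ τ : Str, σ <+: τ → τ ∈ T → σ ∈ T

/-- `[T]`, the set of paths through `T`. -/
def paths (T : Set Str) : Set (ℕ → ℕ) := {X | ∀ n, initSeg X n ∈ T}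

/-- The characteristic function of a set of strings. -/
noncomputable def chi (T : Set Str) : Str → ℕ := fun σ => if σ ∈ T then 1 else 0

/-- A set of strings is `A`-recursive: its characteristic function is computable from `A`. -/
def SetRecIn (A : ℕ → ℕ) (T : Set Str) : Prop :=
  ∃ c : OCode, ∀ σ : Str, evalo A c (Encodable.encode σ) = Part.some (chi T σ)

/-- `P ⊆ ℕ^ℕ` is `Π^{0,A}_1` : `P = [T]` for some `A`-recursive tree `T`. -/
def IsPi01In (A : ℕ → ℕ) (P : Set (ℕ → ℕ)) : Prop :=
  ∃ T : Set Str, IsTree T ∧ SetRecIn A T ∧ P = paths T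

/-- `P ⊆ ℕ^ℕ` is `Π⁰₁` : `P = [T]` for some recursive tree `T`. -/
def IsPi01 (P : Set (ℕ → ℕ)) : Prop := IsPi01In zeroF P

/-! ### Treemaps -/

/-- `F` is a treemap on the tree `T`: `F(σ⌢⟨i⟩) ⊇ F(σ)⌢⟨i⟩` whenever `σ⌢⟨i⟩ ∈ T`. -/
def IsTreemapOn (T : Set Str) (F : Str → Str) : Prop :=
  ∀ (σ : Str) (i : ℕ), σ ++ [i] ∈ T → (F σ) ++ [i] <+: F (σ ++ [i])

/-- The image tree `F(T) = {τ : ∃ σ ∈ T, τ ⊆ F(σ)}`. -/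
def treeImage (F : Str → Str) (T : Set Str) : Set Str :=
  {τ | ∃ σ ∈ T, τ <+: F σ}

/-- The map on paths induced by a treemap: `X ↦ ⋃ₙ F(X↾n)`. -/
def pathMap (F : Str → Str) (X : ℕ → ℕ) : ℕ → ℕ :=
  fun i => (F (initSeg X (i + 1))).getD i 0

/-- The string function `F` is `A`-recursive on `T` (restriction of a partial
    `A`-recursive function). -/
def FnRecInOn (A : ℕ → ℕ) (F : Str → Str) (T : Set Str) : Prop :=
  ∃ c : OCode, ∀ σ ∈ T, evalo A c (Encodable.encode σ) = Part.some (Encodable.encode (F σ))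

/-- `F` maps `P` homeomorphically onto `Q` (subspace topologies from Baire space). -/
def HomeoOn (F : (ℕ → ℕ) → (ℕ → ℕ)) (P Q : Set (ℕ → ℕ)) : Prop :=
  Set.BijOn F P Q ∧ ContinuousOn F P ∧
    ∃ G : (ℕ → ℕ) → (ℕ → ℕ), Set.InvOn G F P Q ∧ ContinuousOn G Q

/-- `f X ≡_T g X` uniformly for all `X ∈ P`: the Turing reductions are given by
    fixed indices independent of `X`. -/
def UnifEquivOn (P : Set (ℕ → ℕ)) (f g : (ℕ → ℕ) → (ℕ → ℕ)) : Prop :=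
  ∃ c d : OCode, ∀ X ∈ P, computesFn (g X) c (f X) ∧ computesFn (f X) d (g X)

/-! ### Standard enumerations -/

/-- `W_e^A`: the `e`-th `A`-recursively enumerable set of strings. -/
def WA (A : ℕ → ℕ) (e : ℕ) : Set Str :=
  {σ | (evalo A (OCode.ofNat e) (Encodable.encode σ)).Dom}

/-- `T_e^A = {σ : ∀ n ≤ |σ|, σ↾n ∉ W_e^A}`: the standard enumeration of `Π^{0,A}_1` trees. -/
def TA (A : ℕ → ℕ) (e : ℕ) : Set Str :=
  {σ | ∀ n ≤ σ.length, σ.take n ∉ WA A e}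

/-- `P_e^A = [T_e^A]`: the standard enumeration of `Π^{0,A}_1` subsets of Baire space. -/
def PA (A : ℕ → ℕ) (e : ℕ) : Set (ℕ → ℕ) := paths (TA A e)

/-! ### The arithmetical hierarchy on Baire space -/

/-- Prepend a number to a point of Baire space. -/
def consF (k : ℕ) (X : ℕ → ℕ) : ℕ → ℕ := fun i => Nat.casesOn i k fun j => X j

/-- `Σ⁰ₙ` subsets of Baire space.  `Σ⁰₀` sets are the recursive clopen sets
    (depending computably on a fixed finite initial segment), and
    `Σ⁰ₙ₊₁` sets are obtained from `Π⁰ₙ` sets by existential number quantification. -/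
def SigmaN : ℕ → Set (ℕ → ℕ) → Prop
  | 0, P => ∃ (k : ℕ) (f : Str → Bool), Computable f ∧ P = {X | f (initSeg X k) = true}
  | n + 1, P => ∃ Q : Set (ℕ → ℕ), SigmaN n Qᶜ ∧ P = {X | ∃ k : ℕ, consF k X ∈ Q}

/-- `Π⁰ₙ` subsets of Baire space: complements of `Σ⁰ₙ` sets. -/
def PiN (n : ℕ) (P : Set (ℕ → ℕ)) : Prop := SigmaN n Pᶜ

/-- Arithmetical subsets of Baire space: `Π⁰ₙ` for some `n`. -/
def IsArith (P : Set (ℕ → ℕ)) : Prop := ∃ n : ℕ, PiN n P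


section helpers

open Encodable Denumerable
open Nat.Partrec (Code)

/-- Evaluation of an oracle code relative to a partial oracle `B`. -/
def evalPart (B : ℕ →. ℕ) : OCode → ℕ →. ℕ
  | OCode.zero => pure 0
  | OCode.succ => fun n => Part.some (n + 1)
  | OCode.left => fun n => Part.some (Nat.unpair n).1
  | OCode.right => fun n => Part.some (Nat.unpair n).2
  | OCode.oracle => B
  | OCode.pair cf cg => fun n => Nat.pair <$> evalPart B cf n <*> evalPart B cg n
  | OCode.comp cf cg => fun n => evalPart B cg n >>= evalPart B cf
  | OCode.prec cf cg =>
    Nat.unpaired fun a n =>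
      n.rec (evalPart B cf a) fun y IH => do
        let i ← IH
        evalPart B cg (Nat.pair a (Nat.pair y i))
  | OCode.rfind' cf =>
    Nat.unpaired fun a m =>
      (Nat.rfind fun n => (fun x => x = 0) <$> evalPart B cf (Nat.pair a (n + m))).map (· + m)

theorem evalo_eq_evalPart (A : ℕ → ℕ) (c : OCode) : evalo A c = evalPart (A : ℕ →. ℕ) c := by
  induction c with
  | pair cf cg hf hg => simp only [evalo, evalPart, hf, hg]; rfl
  | comp cf cg hf hg => simp only [evalo, evalPart, hf, hg]; rfl
  | prec cf cg hf hg => simp only [evalo, evalPart, hf, hg]; rfl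
  | rfind' cf hf => simp only [evalo, evalPart, hf]; rfl
  | _ => rfl

theorem mem_evalPart_pair {B : ℕ →. ℕ} {cf cg : OCode} {x v : ℕ} :
    v ∈ evalPart B (.pair cf cg) x ↔
      ∃ a ∈ evalPart B cf x, ∃ b ∈ evalPart B cg x, Nat.pair a b = v := by
  simp [evalPart, Seq.seq]

theorem mem_evalPart_comp {B : ℕ →. ℕ} {cf cg : OCode} {x v : ℕ} :
    v ∈ evalPart B (.comp cf cg) x ↔ ∃ a ∈ evalPart B cg x, v ∈ evalPart B cf a :=
  Part.mem_bind_iff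

theorem mem_evalPart_prec_zero {B : ℕ →. ℕ} {cf cg : OCode} {a v : ℕ} :
    v ∈ evalPart B (.prec cf cg) (Nat.pair a 0) ↔ v ∈ evalPart B cf a := by
  simp [evalPart]

theorem mem_evalPart_prec_succ {B : ℕ →. ℕ} {cf cg : OCode} {a n v : ℕ} :
    v ∈ evalPart B (.prec cf cg) (Nat.pair a (n + 1)) ↔
      ∃ i ∈ evalPart B (.prec cf cg) (Nat.pair a n),
        v ∈ evalPart B cg (Nat.pair a (Nat.pair n i)) := by
  simp [evalPart]

theorem mem_evalPart_rfind' {B : ℕ →. ℕ} {cf : OCode} {a m v : ℕ} :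
    v ∈ evalPart B (.rfind' cf) (Nat.pair a m) ↔
      ∃ k, v = k + m ∧ 0 ∈ evalPart B cf (Nat.pair a (k + m)) ∧
        ∀ j < k, ∃ w ∈ evalPart B cf (Nat.pair a (j + m)), w ≠ 0 := by
  have e : evalPart B (.rfind' cf) (Nat.pair a m) = (Nat.rfind fun n =>
      Part.map (fun x => decide (x = 0)) (evalPart B cf (Nat.pair a (n + m)))).map (· + m) := by
    simp only [evalPart, Nat.unpaired, Nat.unpair_pair]
    rfl
  rw [e, Part.mem_map_iff]
  constructor
  · rintro ⟨k, hk, rfl⟩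
    obtain ⟨h0, h⟩ := Nat.mem_rfind.1 hk
    refine ⟨k, rfl, ?_, fun j hj => ?_⟩
    · obtain ⟨w, hw, h0⟩ := (Part.mem_map_iff _).1 h0
      simp only [decide_eq_true_eq] at h0
      exact h0 ▸ hw
    · obtain ⟨w, hw, h'⟩ := (Part.mem_map_iff _).1 (h hj)
      exact ⟨w, hw, by simpa using h'⟩
  · rintro ⟨k, rfl, h0, h⟩
    refine ⟨k, Nat.mem_rfind.2 ⟨(Part.mem_map_iff _).2 ⟨0, h0, by simp⟩, fun {j} hj => ?_⟩, rfl⟩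
    obtain ⟨w, hw, h'⟩ := h j hj
    exact (Part.mem_map_iff _).2 ⟨w, hw, by simpa using h'⟩

theorem evalPart_mono {B B' : ℕ →. ℕ} (h : ∀ x v, v ∈ B x → v ∈ B' x) (c : OCode) :
    ∀ x v, v ∈ evalPart B c x → v ∈ evalPart B' c x := by
  induction c with
  | oracle => exact h
  | pair cf cg hf hg =>
    intro x v
    rw [mem_evalPart_pair, mem_evalPart_pair]
    rintro ⟨a, ha, b, hb, e⟩
    exact ⟨a, hf _ _ ha, b, hg _ _ hb, e⟩
  | comp cf cg hf hg =>
    intro x v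
    rw [mem_evalPart_comp, mem_evalPart_comp]
    rintro ⟨a, ha, hb⟩
    exact ⟨a, hg _ _ ha, hf _ _ hb⟩
  | prec cf cg hf hg =>
    intro x
    obtain ⟨a, n, rfl⟩ : ∃ a n, Nat.pair a n = x := ⟨_, _, Nat.pair_unpair x⟩
    induction n with
    | zero => simpa only [mem_evalPart_prec_zero] using hf a
    | succ n ih =>
      intro v
      rw [mem_evalPart_prec_succ, mem_evalPart_prec_succ]
      rintro ⟨i, hi, hv⟩
      exact ⟨i, ih _ hi, hg _ _ hv⟩
  | rfind' cf hf =>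
    intro x
    obtain ⟨a, m, rfl⟩ : ∃ a n, Nat.pair a n = x := ⟨_, _, Nat.pair_unpair x⟩
    intro v
    rw [mem_evalPart_rfind', mem_evalPart_rfind']
    rintro ⟨k, e, h0, hk⟩
    refine ⟨k, e, hf _ _ h0, fun j hj => ?_⟩
    obtain ⟨w, hw, h'⟩ := hk j hj
    exact ⟨w, hf _ _ hw, h'⟩
  | _ => exact fun x v hv => hv

/-- The use principle: a computation from an increasing union of partial oracles already
converges relative to one of them. -/
theorem evalPart_continuous {B : ℕ → ℕ →. ℕ} {C : ℕ →. ℕ}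
    (hB : ∀ m n, m ≤ n → ∀ x v, v ∈ B m x → v ∈ B n x)
    (hC : ∀ x v, v ∈ C x → ∃ n, v ∈ B n x) (c : OCode) :
    ∀ x v, v ∈ evalPart C c x → ∃ n, v ∈ evalPart (B n) c x := by
  have up : ∀ {c m n x v}, v ∈ evalPart (B m) c x → m ≤ n → v ∈ evalPart (B n) c x :=
    fun h hmn => evalPart_mono (hB _ _ hmn) _ _ _ h
  induction c with
  | oracle => exact hC
  | pair cf cg hf hg =>
    intro x v
    simp only [mem_evalPart_pair]
    rintro ⟨a, ha, b, hb, e⟩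
    obtain ⟨m, hm⟩ := hf _ _ ha
    obtain ⟨n, hn⟩ := hg _ _ hb
    exact ⟨max m n, a, up hm (le_max_left _ _), b, up hn (le_max_right _ _), e⟩
  | comp cf cg hf hg =>
    intro x v
    simp only [mem_evalPart_comp]
    rintro ⟨a, ha, hb⟩
    obtain ⟨m, hm⟩ := hg _ _ ha
    obtain ⟨n, hn⟩ := hf _ _ hb
    exact ⟨max m n, a, up hm (le_max_left _ _), up hn (le_max_right _ _)⟩
  | prec cf cg hf hg =>
    intro x
    obtain ⟨a, n, rfl⟩ : ∃ a n, Nat.pair a n = x := ⟨_, _, Nat.pair_unpair x⟩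
    induction n with
    | zero => simpa only [mem_evalPart_prec_zero] using hf a
    | succ n ih =>
      intro v
      simp only [mem_evalPart_prec_succ]
      rintro ⟨i, hi, hv⟩
      obtain ⟨m, hm⟩ := ih _ hi
      obtain ⟨k, hk⟩ := hg _ _ hv
      exact ⟨max m k, i, up hm (le_max_left _ _), up hk (le_max_right _ _)⟩
  | rfind' cf hf =>
    intro x
    obtain ⟨a, m, rfl⟩ : ∃ a n, Nat.pair a n = x := ⟨_, _, Nat.pair_unpair x⟩
    intro v
    simp only [mem_evalPart_rfind']
    rintro ⟨k, e, h0, hk⟩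
    obtain ⟨n₀, hn₀⟩ := hf _ _ h0
    have : ∀ k', k' ≤ k → ∃ n, ∀ j < k', ∃ w ∈ evalPart (B n) cf (Nat.pair a (j + m)), w ≠ 0 := by
      intro k'
      induction k' with
      | zero => exact fun _ => ⟨0, fun j hj => absurd hj (Nat.not_lt_zero _)⟩
      | succ k' ih =>
        intro hk'
        obtain ⟨n, hn⟩ := ih (by omega)
        obtain ⟨w, hw, hw0⟩ := hk k' (by omega)
        obtain ⟨n', hn'⟩ := hf _ _ hw
        refine ⟨max n n', fun j hj => ?_⟩
        rcases Nat.lt_succ_iff_lt_or_eq.1 hj with hj | rfl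
        · obtain ⟨w, hw, h0⟩ := hn j hj
          exact ⟨w, up hw (le_max_left _ _), h0⟩
        · exact ⟨w, up hn' (le_max_right _ _), hw0⟩
    obtain ⟨n, hn⟩ := this k le_rfl
    refine ⟨max n₀ n, k, e, up hn₀ (le_max_left _ _), fun j hj => ?_⟩
    obtain ⟨w, hw, h0⟩ := hn j hj
    exact ⟨w, up hw (le_max_right _ _), h0⟩
  | zero => exact fun x v hv => ⟨0, hv⟩
  | succ => exact fun x v hv => ⟨0, hv⟩
  | left => exact fun x v hv => ⟨0, hv⟩
  | right => exact fun x v hv => ⟨0, hv⟩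

/-- The partial oracle given by a finite string. -/
def lookup (α : Str) : ℕ →. ℕ := fun i => (α[i]? : Option ℕ)

theorem exists_lookup_code :
    ∃ c : Code, ∀ (α : Str) (i : ℕ), c.eval (Nat.pair (encode α) i) = lookup α i := by
  have h : Partrec fun p : Str × ℕ => ((p.1[p.2]? : Option ℕ) : Part ℕ) :=
    Computable.ofOption (Primrec.list_getElem?.to_comp)
  obtain ⟨c, hc⟩ := Code.exists_code.1 (Nat.Partrec.of_eq h fun n => rfl)
  refine ⟨c, fun α i => ?_⟩
  have := congrFun hc (encode (α, i))
  rw [encode_prod_val] at this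
  simp only [encode_nat] at this
  rw [this]
  simp [lookup]
  rfl

/-- A code for looking up entries of finite strings. -/
noncomputable def lookupCode : Code := exists_lookup_code.choose

/-- Replace oracle queries by lookups in a finite string, diverging outside of it. -/
noncomputable def withString (α : Str) : OCode → Code
  | .zero => .zero
  | .succ => .succ
  | .left => .left
  | .right => .right
  | .oracle => .curry lookupCode (encode α)
  | .pair cf cg => .pair (withString α cf) (withString α cg)
  | .comp cf cg => .comp (withString α cf) (withString α cg)
  | .prec cf cg => .prec (withString α cf) (withString α cg)
  | .rfind' cf => .rfind' (withString α cf)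

theorem eval_withString (α : Str) (c : OCode) :
    (withString α c).eval = evalPart (lookup α) c := by
  induction c with
  | oracle =>
    funext i
    exact (Code.eval_curry _ _ _).trans (exists_lookup_code.choose_spec α i)
  | pair cf cg hf hg => simp only [withString, Code.eval, evalPart, hf, hg]; rfl
  | comp cf cg hf hg => simp only [withString, Code.eval, evalPart, hf, hg]; rfl
  | prec cf cg hf hg => simp only [withString, Code.eval, evalPart, hf, hg]; rfl
  | rfind' cf hf => simp only [withString, Code.eval, evalPart, hf]; rfl
  | _ => rfl

theorem ofNat_add_five (n : ℕ) : OCode.ofNat (n + 5) =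
    match n.bodd, n.div2.bodd with
    | false, false =>
      .pair (.ofNat n.div2.div2.unpair.1) (.ofNat n.div2.div2.unpair.2)
    | false, true  =>
      .comp (.ofNat n.div2.div2.unpair.1) (.ofNat n.div2.div2.unpair.2)
    | true,  false =>
      .prec (.ofNat n.div2.div2.unpair.1) (.ofNat n.div2.div2.unpair.2)
    | true,  true  => .rfind' (.ofNat n.div2.div2) := by
  rw [OCode.ofNat]

theorem ofNat_surjective : Function.Surjective OCode.ofNat := by
  intro c
  induction c with
  | zero => exact ⟨0, by simp [OCode.ofNat]⟩
  | succ => exact ⟨1, by simp [OCode.ofNat]⟩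
  | left => exact ⟨2, by simp [OCode.ofNat]⟩
  | right => exact ⟨3, by simp [OCode.ofNat]⟩
  | oracle => exact ⟨4, by simp [OCode.ofNat]⟩
  | pair cf cg hf hg =>
    obtain ⟨a, rfl⟩ := hf
    obtain ⟨b, rfl⟩ := hg
    exact ⟨2 * (2 * Nat.pair a b) + 5, by rw [ofNat_add_five]; simp [Nat.div2_val]⟩
  | comp cf cg hf hg =>
    obtain ⟨a, rfl⟩ := hf
    obtain ⟨b, rfl⟩ := hg
    exact ⟨2 * (2 * Nat.pair a b + 1) + 5, by
      rw [ofNat_add_five]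
      simp [Nat.div2_val]⟩
  | prec cf cg hf hg =>
    obtain ⟨a, rfl⟩ := hf
    obtain ⟨b, rfl⟩ := hg
    exact ⟨2 * (2 * Nat.pair a b) + 1 + 5, by
      rw [ofNat_add_five]
      simp [Nat.div2_val]⟩
  | rfind' cf hf =>
    obtain ⟨a, rfl⟩ := hf
    exact ⟨2 * (2 * a + 1) + 1 + 5, by
      rw [ofNat_add_five]
      simp [Nat.div2_val]⟩

theorem primrec_withString :
    Primrec₂ fun (α : Str) (e : ℕ) => withString α (OCode.ofNat e) := by
  let get (L : List Code) (i : ℕ) : Code := L.getD i .zero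
  let g (α : Str) (L : List Code) : Code :=
    if L.length = 0 then .zero else if L.length = 1 then .succ else
    if L.length = 2 then .left else if L.length = 3 then .right else
    if L.length = 4 then .curry lookupCode (encode α) else
    let m := (L.length - 5).div2.div2
    bif (L.length - 5).bodd then
      bif (L.length - 5).div2.bodd then .rfind' (get L m)
      else .prec (get L m.unpair.1) (get L m.unpair.2)
    else
      bif (L.length - 5).div2.bodd then .comp (get L m.unpair.1) (get L m.unpair.2)
      else .pair (get L m.unpair.1) (get L m.unpair.2)
  have hlen : Primrec fun p : Str × List Code => p.2.length := Primrec.list_length.comp .snd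
  have hs : Primrec fun p : Str × List Code => p.2.length - 5 :=
    Primrec.nat_sub.comp hlen (.const 5)
  have hm : Primrec fun p : Str × List Code => (p.2.length - 5).div2.div2 :=
    Primrec.nat_div2.comp (Primrec.nat_div2.comp hs)
  have hget {f : Str × List Code → ℕ} (hf : Primrec f) :
      Primrec fun p : Str × List Code => get p.2 (f p) :=
    (Primrec.list_getD Code.zero).comp .snd hf
  have h1 := hget (Primrec.fst.comp (Primrec.unpair.comp hm))
  have h2 := hget (Primrec.snd.comp (Primrec.unpair.comp hm))
  have heq (k : ℕ) : PrimrecPred fun p : Str × List Code => p.2.length = k :=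
    Primrec.eq.comp hlen (.const k)
  have hg : Primrec₂ g :=
    Primrec.ite (heq 0) (.const _) <| Primrec.ite (heq 1) (.const _) <|
    Primrec.ite (heq 2) (.const _) <| Primrec.ite (heq 3) (.const _) <|
    Primrec.ite (heq 4)
      (Code.primrec₂_curry.comp (.const _) (Primrec.encode.comp .fst)) <|
    Primrec.cond (Primrec.nat_bodd.comp hs)
      (Primrec.cond (Primrec.nat_bodd.comp (Primrec.nat_div2.comp hs))
        (Code.primrec_rfind'.comp (hget hm)) (Code.primrec₂_prec.comp h1 h2))
      (Primrec.cond (Primrec.nat_bodd.comp (Primrec.nat_div2.comp hs))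
        (Code.primrec₂_comp.comp h1 h2) (Code.primrec₂_pair.comp h1 h2))
  refine Primrec.nat_strong_rec _ (g := fun α L => some (g α L))
    (Primrec.option_some.comp hg) fun α n => ?_
  rw [Option.some_inj]
  have hget' : ∀ i < n, get ((List.range n).map fun e => withString α (OCode.ofNat e)) i =
      withString α (OCode.ofNat i) := by
    intro i hi
    simp [get, List.getD_eq_getElem?_getD, hi]
  rcases n with _ | _ | _ | _ | _ | n
  iterate 5 simp [g, OCode.ofNat, withString]
  have hm : n.div2.div2 < n + 5 := by
    simp only [Nat.div2_val]
    omega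
  have hu1 := lt_of_le_of_lt (Nat.unpair_left_le n.div2.div2) hm
  have hu2 := lt_of_le_of_lt (Nat.unpair_right_le n.div2.div2) hm
  rw [ofNat_add_five]
  have hget'' : ∀ i < n + 5, get ((List.range (n + 1 + 1 + 1 + 1 + 1)).map
      fun e => withString α (OCode.ofNat e)) i = withString α (OCode.ofNat i) := hget'
  simp only [g, List.length_map, List.length_range]
  rw [if_neg (by omega), if_neg (by omega), if_neg (by omega), if_neg (by omega),
    if_neg (by omega)]
  rw [show n + 1 + 1 + 1 + 1 + 1 - 5 = n from rfl, hget'' _ hm, hget'' _ hu1, hget'' _ hu2]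
  cases n.bodd <;> cases n.div2.bodd <;> rfl

section uniform

@[simp] theorem length_initSeg (X : ℕ → ℕ) (n : ℕ) : (initSeg X n).length = n := by
  simp [initSeg]

theorem getElem?_initSeg (X : ℕ → ℕ) (n i : ℕ) :
    (initSeg X n)[i]? = if i < n then some (X i) else none := by
  by_cases h : i < n <;> simp [initSeg, h]

theorem initSeg_take (X : ℕ → ℕ) (n l : ℕ) : (initSeg X n).take l = initSeg X (min l n) := by
  simp [initSeg, ← List.map_take, List.take_range]

theorem initSeg_succ (X : ℕ → ℕ) (n : ℕ) : initSeg X (n + 1) = initSeg X n ++ [X n] := by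
  simp [initSeg, List.range_succ]

theorem initSeg_prefix (X : ℕ → ℕ) {m n : ℕ} (h : m ≤ n) : initSeg X m <+: initSeg X n := by
  rw [← min_eq_left h, ← initSeg_take]
  exact List.take_prefix _ _

theorem initSeg_congr {X Y : ℕ → ℕ} {n : ℕ} (h : ∀ i < n, X i = Y i) :
    initSeg X n = initSeg Y n :=
  List.map_congr_left fun i hi => h i (List.mem_range.1 hi)

theorem mem_lookup_initSeg {A : ℕ → ℕ} {n x v : ℕ} :
    v ∈ lookup (initSeg A n) x ↔ x < n ∧ A x = v := by
  unfold lookup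
  rw [getElem?_initSeg]
  split_ifs with h <;> simp [h, eq_comm]

/-- The result of running the `e`-th machine on `x` for `α.length` steps with oracle `α↾l`. -/
noncomputable def runStr (e : ℕ) (α : Str) (x l : ℕ) : Option ℕ :=
  Code.evaln α.length (withString (α.take l) (OCode.ofNat e)) x

/-- The `e`-th machine with a prefix of `α` as its oracle returns `v` on input `x` within
`α.length` steps. -/
def ConvTo (e : ℕ) (α : Str) (x v : ℕ) : Prop := ∃ l < α.length + 1, runStr e α x l = some v

/-- The `e`-th machine with a prefix of `α` as its oracle halts on input `x` within
`α.length` steps. -/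
def Conv (e : ℕ) (α : Str) (x : ℕ) : Prop := ∃ l < α.length + 1, runStr e α x l ≠ none

theorem conv_iff {e : ℕ} {α : Str} {x : ℕ} : Conv e α x ↔ ∃ v, ConvTo e α x v := by
  unfold Conv ConvTo
  constructor
  · rintro ⟨l, hl, h⟩
    obtain ⟨v, hv⟩ := Option.ne_none_iff_exists'.1 h
    exact ⟨v, l, hl, hv⟩
  · rintro ⟨v, l, hl, h⟩
    exact ⟨l, hl, by simp [h]⟩

theorem ConvTo.mono {e : ℕ} {α β : Str} {x v : ℕ} (h : ConvTo e α x v) (hp : α <+: β) :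
    ConvTo e β x v := by
  obtain ⟨l, hl, h⟩ := h
  obtain ⟨γ, rfl⟩ := hp
  refine ⟨l, by simp; omega, ?_⟩
  unfold runStr at h ⊢
  rw [List.take_append_of_le_length (by omega)]
  exact Code.evaln_mono (by simp) h

theorem Conv.mono {e : ℕ} {α β : Str} {x : ℕ} (h : Conv e α x) (hp : α <+: β) : Conv e β x := by
  obtain ⟨v, hv⟩ := conv_iff.1 h
  exact conv_iff.2 ⟨v, hv.mono hp⟩

theorem mem_evalo_iff {A : ℕ → ℕ} {e x v : ℕ} :
    v ∈ evalo A (OCode.ofNat e) x ↔ ∃ n, ConvTo e (initSeg A n) x v := by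
  rw [evalo_eq_evalPart]
  constructor
  · intro h
    obtain ⟨n, hn⟩ := evalPart_continuous (B := fun n => lookup (initSeg A n))
      (fun m n hmn x v hx => by
        rw [mem_lookup_initSeg] at hx ⊢
        exact ⟨by omega, hx.2⟩)
      (fun x v hx => ⟨x + 1, mem_lookup_initSeg.2 ⟨by omega, by simpa [eq_comm] using hx⟩⟩)
      _ _ _ h
    rw [← eval_withString, Code.evaln_complete] at hn
    obtain ⟨k, hk⟩ := hn
    refine ⟨max k n, n, by simp, ?_⟩
    unfold runStr
    rw [initSeg_take, min_eq_left (le_max_right _ _)]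
    exact Code.evaln_mono (by simp) hk
  · rintro ⟨n, l, -, h⟩
    have h := Code.evaln_sound h
    rw [eval_withString, initSeg_take] at h
    refine evalPart_mono (fun y w hw => ?_) _ _ _ h
    rw [mem_lookup_initSeg] at hw
    simp [hw.2]

theorem dom_evalo_iff {A : ℕ → ℕ} {e x : ℕ} :
    (evalo A (OCode.ofNat e) x).Dom ↔ ∃ n, Conv e (initSeg A n) x := by
  rw [Part.dom_iff_mem]
  simp only [mem_evalo_iff, conv_iff]
  exact exists_comm

theorem primrec_runStr :
    Primrec fun p : ℕ × Str × ℕ × ℕ => runStr p.1 p.2.1 p.2.2.1 p.2.2.2 := by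
  have h1 : Primrec fun p : ℕ × Str × ℕ × ℕ => p.2.1 := .comp .fst .snd
  have h2 : Primrec fun p : ℕ × Str × ℕ × ℕ => p.2.2.1 := .comp .fst (.comp .snd .snd)
  have h3 : Primrec fun p : ℕ × Str × ℕ × ℕ => p.2.2.2 := .comp .snd (.comp .snd .snd)
  exact Code.primrec_evaln.comp <| .pair
    (.pair (Primrec.list_length.comp h1)
      (primrec_withString.comp (Primrec.list_take.comp h3 h1) .fst)) h2

/-! ### Functions computable uniformly in a family of oracles -/

variable {I : Type*} {O : I → ℕ → ℕ} {α β γ δ : Type} [Primcodable α] [Primcodable β]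
  [Primcodable γ] [Primcodable δ]

/-- The functions `f i` are computable from the oracles `O i` by a single code. -/
def UC (O : I → ℕ → ℕ) (f : I → α → β) : Prop :=
  ∃ c, ∀ i a, evalo (O i) c (encode a) = Part.some (encode (f i a))

/-- The predicates `p i` are decidable from the oracles `O i` by a single code. -/
def UD (O : I → ℕ → ℕ) (p : I → α → Prop) : Prop :=
  ∃ f : I → α → Bool, UC O f ∧ ∀ i a, f i a = true ↔ p i a

/-- Oracle machines simulate machines without oracle. -/
def ofCode : Code → OCode
  | .zero => .zero
  | .succ => .succ
  | .left => .left
  | .right => .right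
  | .pair cf cg => .pair (ofCode cf) (ofCode cg)
  | .comp cf cg => .comp (ofCode cf) (ofCode cg)
  | .prec cf cg => .prec (ofCode cf) (ofCode cg)
  | .rfind' cf => .rfind' (ofCode cf)

theorem evalo_ofCode (A : ℕ → ℕ) (c : Code) : evalo A (ofCode c) = c.eval := by
  induction c with
  | pair cf cg hf hg => simp only [ofCode, Code.eval, evalo, hf, hg]; rfl
  | comp cf cg hf hg => simp only [ofCode, Code.eval, evalo, hf, hg]; rfl
  | prec cf cg hf hg => simp only [ofCode, Code.eval, evalo, hf, hg]; rfl
  | rfind' cf hf => simp only [ofCode, Code.eval, evalo, hf]; rfl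
  | _ => rfl

/-- Replace oracle queries by runs of the code `d`. -/
def substCode (d : OCode) : OCode → OCode
  | .oracle => d
  | .pair cf cg => .pair (substCode d cf) (substCode d cg)
  | .comp cf cg => .comp (substCode d cf) (substCode d cg)
  | .prec cf cg => .prec (substCode d cf) (substCode d cg)
  | .rfind' cf => .rfind' (substCode d cf)
  | c => c

theorem evalo_substCode {A B : ℕ → ℕ} {d : OCode} (hd : computesFn A d B) (c : OCode) :
    evalo A (substCode d c) = evalo B c := by
  induction c with
  | oracle => exact funext hd
  | pair cf cg hf hg => simp only [substCode, evalo, hf, hg]; rfl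
  | comp cf cg hf hg => simp only [substCode, evalo, hf, hg]; rfl
  | prec cf cg hf hg => simp only [substCode, evalo, hf, hg]; rfl
  | rfind' cf hf => simp only [substCode, evalo, hf]; rfl
  | _ => rfl

namespace UC

theorem of_eq {f g : I → α → β} (hf : UC O f) (h : ∀ i a, f i a = g i a) : UC O g :=
  (funext fun i => funext (h i) : f = g) ▸ hf

theorem of_computable {g : α → β} (hg : Computable g) : UC O fun _ a => g a := by
  obtain ⟨c, hc⟩ := Code.exists_code.1 hg
  refine ⟨ofCode c, fun i a => ?_⟩
  rw [evalo_ofCode]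
  refine (congrFun hc (encode a)).trans ?_
  simp [encodek]

theorem of_primrec {g : α → β} (hg : Primrec g) : UC O fun _ a => g a := of_computable hg.to_comp

theorem id : UC O fun _ (a : α) => a := of_primrec .id

theorem const (b : β) : UC O fun _ (_ : α) => b := of_primrec (.const b)

theorem oracle : UC O O := ⟨.oracle, fun _ _ => rfl⟩

theorem comp {g : I → β → γ} {f : I → α → β} (hg : UC O g) (hf : UC O f) :
    UC O fun i a => g i (f i a) := by
  obtain ⟨c, hc⟩ := hg
  obtain ⟨d, hd⟩ := hf
  refine ⟨.comp c d, fun i a => ?_⟩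
  simp only [evalo]
  rw [hd]
  exact (Part.bind_some _ _).trans (hc _ _)

theorem pair {f : I → α → β} {g : I → α → γ} (hf : UC O f) (hg : UC O g) :
    UC O fun i a => (f i a, g i a) := by
  obtain ⟨c, hc⟩ := hf
  obtain ⟨d, hd⟩ := hg
  refine ⟨.pair c d, fun i a => ?_⟩
  simp only [evalo]
  rw [hc, hd]
  simp [Seq.seq]

theorem map {g : β → γ} {f : I → α → β} (hg : Primrec g) (hf : UC O f) :
    UC O fun i a => g (f i a) :=
  (of_primrec hg).comp hf

theorem map₂ {g : β → γ → δ} {f : I → α → β} {f' : I → α → γ} (hg : Primrec₂ g) (hf : UC O f)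
    (hf' : UC O f') : UC O fun i a => g (f i a) (f' i a) :=
  map (g := fun p : β × γ => g p.1 p.2) hg (hf.pair hf')

theorem fst : UC O fun _ (p : α × β) => p.1 := of_primrec .fst

theorem snd : UC O fun _ (p : α × β) => p.2 := of_primrec .snd

theorem reindex {J : Type*} {f : I → α → β} (hf : UC O f) (r : J → I) :
    UC (fun j => O (r j)) fun j => f (r j) := by
  obtain ⟨c, hc⟩ := hf
  exact ⟨c, fun j => hc (r j)⟩

theorem trans {B : I → ℕ → ℕ} {f : I → α → β} (hf : UC B f) (hB : UC O B) : UC O f := by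
  obtain ⟨c, hc⟩ := hf
  obtain ⟨d, hd⟩ := hB
  exact ⟨substCode d c, fun i a => by rw [evalo_substCode (hd i)]; exact hc i a⟩

theorem nat_rec {f : I → α → β} {g : I → α × ℕ × β → β} (hf : UC O f) (hg : UC O g) :
    UC O fun i (p : α × ℕ) => (Nat.rec (f i p.1) (fun y ih => g i (p.1, y, ih)) p.2 : β) := by
  obtain ⟨c, hc⟩ := hf
  obtain ⟨d, hd⟩ := hg
  refine ⟨.prec c d, fun i ⟨a, n⟩ => ?_⟩
  simp only [evalo, encode_prod_val, Nat.unpaired, Nat.unpair_pair, encode_nat]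
  induction n with
  | zero => exact hc i a
  | succ n ih =>
    simp only at ih ⊢
    rw [ih]
    refine (Part.bind_some _ _).trans ?_
    rw [← hd]
    rfl

theorem cond {b : I → α → Bool} {f g : I → α → β} (hb : UC O b) (hf : UC O f) (hg : UC O g) :
    UC O fun i a => bif b i a then f i a else g i a :=
  map (g := fun p : Bool × β × β => bif p.1 then p.2.1 else p.2.2)
    (.cond .fst (.comp .fst .snd) (.comp .snd .snd)) (hb.pair (hf.pair hg))

end UC

namespace UD

theorem of_iff {p q : I → α → Prop} (hp : UD O p) (h : ∀ i a, p i a ↔ q i a) : UD O q := by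
  obtain ⟨f, hf, H⟩ := hp
  exact ⟨f, hf, fun i a => (H i a).trans (h i a)⟩

theorem of_primrec {p : α → Prop} (hp : PrimrecPred p) : UD O fun _ a => p a := by
  obtain ⟨_, hp⟩ := hp
  exact ⟨_, .of_primrec hp, by simp⟩

theorem comp {p : I → β → Prop} {f : I → α → β} (hp : UD O p) (hf : UC O f) :
    UD O fun i a => p i (f i a) := by
  obtain ⟨g, hg, H⟩ := hp
  exact ⟨_, hg.comp hf, fun i a => H _ _⟩

theorem rel {p : β → γ → Prop} {f : I → α → β} {g : I → α → γ} (hp : PrimrecRel p) (hf : UC O f)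
    (hg : UC O g) : UD O fun i a => p (f i a) (g i a) :=
  comp (p := fun _ (q : β × γ) => p q.1 q.2) (of_primrec hp) (hf.pair hg)

theorem reindex {J : Type*} {p : I → α → Prop} (hp : UD O p) (r : J → I) :
    UD (fun j => O (r j)) fun j => p (r j) := by
  obtain ⟨f, hf, H⟩ := hp
  exact ⟨_, hf.reindex r, fun j => H (r j)⟩

theorem trans {B : I → ℕ → ℕ} {p : I → α → Prop} (hp : UD B p) (hB : UC O B) : UD O p := by
  obtain ⟨f, hf, H⟩ := hp
  exact ⟨f, hf.trans hB, H⟩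

theorem not {p : I → α → Prop} (hp : UD O p) : UD O fun i a => ¬ p i a := by
  obtain ⟨f, hf, H⟩ := hp
  exact ⟨_, .map Primrec.not hf, fun i a => by simp [← H]⟩

theorem and {p q : I → α → Prop} (hp : UD O p) (hq : UD O q) : UD O fun i a => p i a ∧ q i a := by
  obtain ⟨f, hf, H⟩ := hp
  obtain ⟨g, hg, K⟩ := hq
  exact ⟨_, .map₂ Primrec.and hf hg, fun i a => by simp [← H, ← K]⟩

theorem or {p q : I → α → Prop} (hp : UD O p) (hq : UD O q) : UD O fun i a => p i a ∨ q i a := by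
  obtain ⟨f, hf, H⟩ := hp
  obtain ⟨g, hg, K⟩ := hq
  exact ⟨_, .map₂ Primrec.or hf hg, fun i a => by simp [← H, ← K]⟩

theorem imp {p q : I → α → Prop} (hp : UD O p) (hq : UD O q) : UD O fun i a => p i a → q i a :=
  (hp.not.or hq).of_iff fun _ _ => imp_iff_not_or.symm

theorem exists_lt {p : I → α × ℕ → Prop} {b : I → α → ℕ} (hp : UD O p) (hb : UC O b) :
    UD O fun i a => ∃ n < b i a, p i (a, n) := by
  obtain ⟨f, hf, H⟩ := hp
  have h := UC.nat_rec (O := O) (α := α) (β := Bool) (f := fun _ _ => false)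
    (g := fun i q => f i (q.1, q.2.1) || q.2.2) (.const _)
    (.map₂ Primrec.or (hf.comp (UC.fst.pair (UC.fst.comp UC.snd))) (UC.snd.comp UC.snd))
  refine ⟨_, h.comp (UC.id.pair hb), fun i a => ?_⟩
  simp only
  induction b i a with
  | zero => simp
  | succ n ih =>
    simp only [Bool.or_eq_true, ih, H]
    constructor
    · rintro (h | ⟨m, hm, h⟩)
      · exact ⟨n, by omega, h⟩
      · exact ⟨m, by omega, h⟩
    · rintro ⟨m, hm, h⟩
      rcases Nat.lt_succ_iff_lt_or_eq.1 hm with hm | rfl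
      · exact .inr ⟨m, hm, h⟩
      · exact .inl h

theorem forall_lt {p : I → α × ℕ → Prop} {b : I → α → ℕ} (hp : UD O p) (hb : UC O b) :
    UD O fun i a => ∀ n < b i a, p i (a, n) :=
  (hp.not.exists_lt hb).not.of_iff fun i a => by simp

end UD

theorem UC.ite {p : I → α → Prop} {f g : I → α → β} [∀ i a, Decidable (p i a)] (hp : UD O p)
    (hf : UC O f) (hg : UC O g) : UC O fun i a => if p i a then f i a else g i a := by
  obtain ⟨b, hb, H⟩ := hp
  refine (hb.cond hf hg).of_eq fun i a => ?_
  by_cases h : p i a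
  · simp [h, (H i a).2 h]
  · have : b i a = false := by simpa [← H] using h
    simp [h, this]

theorem UC.decide {p : I → α → Prop} [∀ i a, Decidable (p i a)] (hp : UD O p) :
    UC O fun i a => decide (p i a) := by
  obtain ⟨b, hb, H⟩ := hp
  exact hb.of_eq fun i a => Bool.eq_iff_iff.2 (by simp [H])

theorem exists_search {p : I → α × ℕ → Prop} (hp : UD O p) :
    ∃ c, ∀ i a v, v ∈ evalo (O i) c (encode a) ↔ p i (a, v) ∧ ∀ m < v, ¬ p i (a, m) := by
  have h : UC O fun i (q : α × ℕ) => if p i q then 0 else 1 := .ite hp (.const 0) (.const 1)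
  obtain ⟨c, hc⟩ := h
  obtain ⟨d, hd⟩ : UC O fun _ (a : α) => (a, 0) := UC.id.pair (.const 0)
  refine ⟨.comp (.rfind' c) d, fun i a v => ?_⟩
  rw [evalo_eq_evalPart, mem_evalPart_comp, ← evalo_eq_evalPart, ← evalo_eq_evalPart, hd]
  simp only [Part.mem_some_iff, exists_eq_left, encode_prod_val, encode_nat]
  rw [evalo_eq_evalPart, mem_evalPart_rfind', ← evalo_eq_evalPart]
  have hc' (n : ℕ) : evalo (O i) c (Nat.pair (encode a) n) =
      Part.some (if p i (a, n) then 0 else 1) := hc i (a, n)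
  simp only [add_zero, hc', Part.mem_some_iff]
  constructor
  · rintro ⟨k, rfl, h0, h⟩
    refine ⟨by by_contra hn; simp [hn] at h0, fun m hm hpm => ?_⟩
    obtain ⟨w, rfl, hw⟩ := h m hm
    simp [hpm] at hw
  · rintro ⟨h0, h⟩
    exact ⟨v, rfl, by simp [h0], fun j hj => ⟨_, rfl, by simp [h j hj]⟩⟩

theorem UC.find {p : I → α × ℕ → Prop} (hp : UD O p) {f : I → α → ℕ}
    (hf : ∀ i a, p i (a, f i a) ∧ ∀ m < f i a, ¬ p i (a, m)) : UC O f := by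
  obtain ⟨c, hc⟩ := exists_search hp
  exact ⟨c, fun i a => Part.eq_some_iff.2 ((hc i a _).2 (hf i a))⟩

end uniform

section classes

variable {I : Type*} {O : I → ℕ → ℕ} {α β γ δ : Type} [Primcodable α] [Primcodable β]
  [Primcodable γ] [Primcodable δ]

theorem UC.initSeg {X : I → α → ℕ → ℕ} {n : I → α → ℕ}
    (hX : UC O fun i (p : α × ℕ) => X i p.1 p.2) (hn : UC O n) :
    UC O fun i a => initSeg (X i a) (n i a) := by
  have h := UC.nat_rec (O := O) (α := α) (β := Str) (f := fun _ _ => [])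
    (g := fun i q => q.2.2 ++ [X i q.1 q.2.1]) (.const _)
    (.map₂ (g := fun (l : Str) (b : ℕ) => l ++ [b]) Primrec.list_concat (UC.snd.comp UC.snd)
      (hX.comp (UC.fst.pair (UC.fst.comp UC.snd))))
  refine (h.comp (UC.id.pair hn)).of_eq fun i a => ?_
  simp only
  induction n i a with
  | zero => rfl
  | succ n ih => rw [initSeg_succ, ← ih]

theorem UC.oplus₂ {X Y : I → α → ℕ → ℕ} (hX : UC O fun i (p : α × ℕ) => X i p.1 p.2)
    (hY : UC O fun i (p : α × ℕ) => Y i p.1 p.2) :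
    UC O fun i (p : α × ℕ) => oplus (X i p.1) (Y i p.1) p.2 := by
  have hdiv : UC O fun _ (p : α × ℕ) => (p.1, p.2 / 2) :=
    UC.fst.pair (.of_primrec (Primrec.nat_div.comp .snd (.const 2)))
  exact UC.ite (.of_primrec (Primrec.eq.comp (Primrec.nat_mod.comp .snd (.const 2)) (.const 0)))
    (hX.comp hdiv) (hY.comp hdiv)

theorem UC.oplus {X Y : I → ℕ → ℕ} (hX : UC O X) (hY : UC O Y) :
    UC O fun i => oplus (X i) (Y i) :=
  (UC.oplus₂ (α := Unit) (X := fun i _ => X i) (Y := fun i _ => Y i) (hX.comp .snd)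
    (hY.comp .snd)).comp ((UC.const ()).pair .id)

theorem oplus_two_mul (A B : ℕ → ℕ) (n : ℕ) : oplus A B (2 * n) = A n := by
  simp [Harrington.oplus]

theorem oplus_two_mul_add_one (A B : ℕ → ℕ) (n : ℕ) : oplus A B (2 * n + 1) = B n := by
  simp [Harrington.oplus, Nat.add_mod, show (2 * n + 1) / 2 = n by omega]

theorem UC.of_oplus_left {X Y : I → ℕ → ℕ} (h : UC O fun i => Harrington.oplus (X i) (Y i)) :
    UC O X :=
  (h.comp (.of_primrec (Primrec.nat_mul.comp (.const 2) .id))).of_eq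
    fun _ _ => oplus_two_mul _ _ _

theorem UC.of_oplus_right {X Y : I → ℕ → ℕ} (h : UC O fun i => Harrington.oplus (X i) (Y i)) :
    UC O Y :=
  (h.comp (.of_primrec (Primrec.succ.comp (Primrec.nat_mul.comp (.const 2) .id)))).of_eq
    fun _ _ => oplus_two_mul_add_one _ _ _

theorem UC.left {X Y : I → ℕ → ℕ} : UC (fun i => Harrington.oplus (X i) (Y i)) X :=
  of_oplus_left .oracle

theorem UC.right {X Y : I → ℕ → ℕ} : UC (fun i => Harrington.oplus (X i) (Y i)) Y :=
  of_oplus_right .oracle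

theorem UD.convTo {e x v : I → α → ℕ} {s : I → α → Str} (he : UC O e) (hs : UC O s)
    (hx : UC O x) (hv : UC O v) : UD O fun i a => ConvTo (e i a) (s i a) (x i a) (v i a) := by
  have h : UC O fun i (p : α × ℕ) => runStr (e i p.1) (s i p.1) (x i p.1) p.2 :=
    .map primrec_runStr ((he.comp .fst).pair ((hs.comp .fst).pair ((hx.comp .fst).pair .snd)))
  exact UD.exists_lt (p := fun i p => runStr (e i p.1) (s i p.1) (x i p.1) p.2 = some (v i p.1))
    (.rel Primrec.eq h (.map Primrec.option_some (hv.comp .fst)))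
    (.map Primrec.succ (.map Primrec.list_length hs))

theorem UD.conv {e x : I → α → ℕ} {s : I → α → Str} (he : UC O e) (hs : UC O s)
    (hx : UC O x) : UD O fun i a => Conv (e i a) (s i a) (x i a) := by
  have h : UC O fun i (p : α × ℕ) => runStr (e i p.1) (s i p.1) (x i p.1) p.2 :=
    .map primrec_runStr ((he.comp .fst).pair ((hs.comp .fst).pair ((hx.comp .fst).pair .snd)))
  exact UD.exists_lt (p := fun i p => runStr (e i p.1) (s i p.1) (x i p.1) p.2 ≠ none)
    (UD.rel Primrec.eq h (.const _)).not (.map Primrec.succ (.map Primrec.list_length hs))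

/-! ### The jump -/

/-- An index of the machine that returns `m` on every input. -/
def constIndex (m : ℕ) : ℕ :=
  Nat.rec 0 (fun _ e => 2 * (2 * Nat.pair 1 e + 1) + 5) m

theorem ofNat_comp (a b : ℕ) : OCode.ofNat (2 * (2 * Nat.pair a b + 1) + 5) =
    .comp (.ofNat a) (.ofNat b) := by
  rw [ofNat_add_five]
  simp [Nat.div2_val]

theorem primrec_constIndex : Primrec constIndex := by
  refine Primrec.nat_rec₁ 0 (Primrec.nat_add.comp (Primrec.nat_mul.comp (.const 2)
    (Primrec.succ.comp (Primrec.nat_mul.comp (.const 2)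
      (Primrec₂.natPair.comp (.const 1) .snd)))) (.const 5))

theorem evalo_constIndex (A : ℕ → ℕ) (m x : ℕ) :
    evalo A (.ofNat (constIndex m)) x = Part.some m := by
  induction m with
  | zero => simp [constIndex, OCode.ofNat, evalo]; rfl
  | succ m ih =>
    change evalo A (.ofNat (2 * (2 * Nat.pair 1 (constIndex m) + 1) + 5)) x = _
    rw [ofNat_comp]
    simp only [evalo]
    rw [ih]
    refine (Part.bind_some _ _).trans ?_
    simp [OCode.ofNat, evalo]

theorem UD.query {p : I → α × ℕ → Prop} (hp : UD O p) :
    UD (fun i => jump (O i)) fun i a => ∃ n, p i (a, n) := by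
  obtain ⟨c, hc⟩ := exists_search hp
  obtain ⟨u, rfl⟩ := ofNat_surjective c
  have hs : Primrec fun a : α => 2 * (2 * Nat.pair u (constIndex (encode a)) + 1) + 5 :=
    Primrec.nat_add.comp (Primrec.nat_mul.comp (.const 2)
      (Primrec.succ.comp (Primrec.nat_mul.comp (.const 2)
        (Primrec₂.natPair.comp (.const u) (primrec_constIndex.comp .encode))))) (.const 5)
  have h := UC.oracle (O := fun i => jump (O i)) |>.comp (.of_primrec hs)
  refine (UD.rel Primrec.eq h (.const 1)).of_iff fun i a => ?_
  have hd : (evalo (O i) (.ofNat (2 * (2 * Nat.pair u (constIndex (encode a)) + 1) + 5))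
      (2 * (2 * Nat.pair u (constIndex (encode a)) + 1) + 5)).Dom ↔ ∃ n, p i (a, n) := by
    rw [ofNat_comp]
    simp only [evalo]
    rw [evalo_constIndex, show (Part.some (encode a) >>= evalo (O i) (OCode.ofNat u)) =
      evalo (O i) (OCode.ofNat u) (encode a) from Part.bind_some _ _, Part.dom_iff_mem]
    constructor
    · rintro ⟨v, hv⟩
      exact ⟨v, ((hc i a v).1 hv).1⟩
    · intro h
      exact ⟨Nat.find h, (hc i a _).2 ⟨Nat.find_spec h, fun m => Nat.find_min h⟩⟩
  rw [← hd, jump]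
  split_ifs with h <;> simp [h]

theorem UC.oracle_jump : UC (fun i => jump (O i)) O := by
  have h : UD O fun i (q : (ℕ × ℕ) × ℕ) => O i q.1.1 = q.1.2 :=
    .rel Primrec.eq (UC.oracle.comp (UC.fst.comp .fst)) (UC.snd.comp .fst)
  refine UC.find (h.query.of_iff (q := fun i q => O i q.1 = q.2) 
    fun i a => ⟨fun ⟨_, h⟩ => h, fun h => ⟨0, h⟩⟩) ?_
  exact fun i a => ⟨rfl, fun m hm => hm.ne'⟩

theorem UC.to_jump {f : I → α → β} (hf : UC O f) : UC (fun i => jump (O i)) f :=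
  hf.trans .oracle_jump

theorem UD.to_jump {p : I → α → Prop} (hp : UD O p) : UD (fun i => jump (O i)) p :=
  hp.trans .oracle_jump

theorem UC.jump {g : I → ℕ → ℕ} (hg : UC O g) :
    UC (fun i => jump (O i)) fun i => Harrington.jump (g i) := by
  have h : UD O fun i (q : ℕ × ℕ) => Conv q.1 (Harrington.initSeg (g i) q.2) q.1 :=
    .conv .fst (UC.initSeg (X := fun i _ => g i) (hg.comp .snd) .snd) .fst
  refine (UC.ite h.query (.const 1) (.const 0)).of_eq fun i e => ?_
  unfold Harrington.jump
  simp only [dom_evalo_iff]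

/-! ### Strings as approximations of points -/

/-- The initial segment of `X ⊕ A` determined by an initial segment of `X`. -/
def joinSeg (A : ℕ → ℕ) (σ : Str) : Str := initSeg (oplus (fun i => σ.getD i 0) A) (2 * σ.length)

theorem prefix_initSeg_iff {σ : Str} {X : ℕ → ℕ} {n : ℕ} (h : σ.length ≤ n) :
    σ <+: initSeg X n ↔ σ = initSeg X σ.length := by
  rw [List.prefix_iff_eq_take, initSeg_take, min_eq_left h]

theorem getD_initSeg {X : ℕ → ℕ} {n i : ℕ} (h : i < n) : (initSeg X n).getD i 0 = X i := by
  rw [List.getD_eq_getElem?_getD, getElem?_initSeg, if_pos h]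
  rfl

theorem initSeg_getD (σ : Str) : initSeg (fun i => σ.getD i 0) σ.length = σ := by
  apply List.ext_getElem?
  intro i
  rw [getElem?_initSeg]
  split_ifs with h
  · simp [h]
  · simp [not_lt.1 h]

theorem joinSeg_initSeg (A X : ℕ → ℕ) (n : ℕ) :
    joinSeg A (initSeg X n) = initSeg (oplus X A) (2 * n) := by
  unfold joinSeg
  rw [length_initSeg]
  refine initSeg_congr fun i hi => ?_
  simp only [oplus, getD_initSeg (show i / 2 < n by omega)]

theorem joinSeg_mono (A : ℕ → ℕ) {σ τ : Str} (h : σ <+: τ) : joinSeg A σ <+: joinSeg A τ := by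
  have hl := h.length_le
  rw [← initSeg_getD τ, prefix_initSeg_iff hl] at h
  have hσ := joinSeg_initSeg A (fun i => τ.getD i 0) σ.length
  have hτ := joinSeg_initSeg A (fun i => τ.getD i 0) τ.length
  rw [← h] at hσ
  rw [initSeg_getD] at hτ
  rw [hσ, hτ]
  exact initSeg_prefix _ (by omega)

theorem UC.joinSeg {A : ℕ → ℕ} {s : I → α → Str} (hA : UC O fun _ => A) (hs : UC O s) :
    UC O fun i a => joinSeg A (s i a) :=
  UC.initSeg (X := fun i a => Harrington.oplus (fun j => (s i a).getD j 0) A)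
    (UC.oplus₂ (X := fun i a j => (s i a).getD j 0) (Y := fun _ _ => A)
      (.map₂ (g := fun (l : Str) j => l.getD j 0) (Primrec.list_getD 0) (hs.comp .fst) .snd)
      (hA.comp .snd))
    (.map₂ Primrec.nat_mul (.const 2) (.map Primrec.list_length hs))

theorem UC.lift {A : ℕ → ℕ} {f : α → β} (hf : UC (fun _ : Unit => A) fun _ => f)
    (hA : UC O fun _ => A) : UC O fun _ => f :=
  UC.trans (B := fun _ => A) (hf.reindex fun _ => ()) hA

theorem UD.lift {A : ℕ → ℕ} {p : α → Prop} (hp : UD (fun _ : Unit => A) fun _ => p)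
    (hA : UC O fun _ => A) : UD O fun _ => p :=
  UD.trans (B := fun _ => A) (hp.reindex fun _ => ()) hA

theorem SetRecIn.ud {A : ℕ → ℕ} {T : Set Str} (h : SetRecIn A T) :
    UD (fun _ : Unit => A) fun _ σ => σ ∈ T := by
  obtain ⟨c, hc⟩ := h
  have h : UC (fun _ : Unit => A) fun _ σ => chi T σ := ⟨c, fun _ σ => hc σ⟩
  refine (UD.rel Primrec.eq h (.const 1)).of_iff fun i σ => ?_
  unfold chi
  split_ifs with h <;> simp [h]

theorem SetRecIn.of_ud {A : ℕ → ℕ} {T : Set Str} (h : UD (fun _ : Unit => A) fun _ σ => σ ∈ T) :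
    SetRecIn A T := by
  obtain ⟨c, hc⟩ : UC (fun _ : Unit => A) fun _ σ => chi T σ := .ite h (.const 1) (.const 0)
  exact ⟨c, fun σ => hc () σ⟩

theorem isPi01In_of_ud {A : ℕ → ℕ} {p : (ℕ → ℕ) → ℕ → Prop} (hp : UD (fun Y => oplus Y A) p) :
    IsPi01In A {Y | ∀ n, p Y n} := by
  obtain ⟨f, ⟨c, hc⟩, hf⟩ := hp
  obtain ⟨e, rfl⟩ := ofNat_surjective c
  have key (Y : ℕ → ℕ) (n : ℕ) :
      (∃ m, ConvTo e (initSeg (oplus Y A) m) n 0) ↔ ¬ p Y n := by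
    rw [← mem_evalo_iff, ← hf]
    have := hc Y n
    simp only [encode_nat] at this
    rw [this]
    cases f Y n <;> simp
  let T : Set Str := {σ | ∀ n < σ.length + 1, ¬ ConvTo e (joinSeg A σ) n 0}
  refine ⟨T, fun σ τ h hτ n hn hc => ?_, SetRecIn.of_ud ?_, ?_⟩
  · exact hτ n (by have := h.length_le; omega) (hc.mono (joinSeg_mono A h))
  · exact UD.forall_lt (p := fun _ q => ¬ ConvTo e (joinSeg A q.1) q.2 0)
      (UD.convTo (.const e) (UC.joinSeg (UC.oracle (O := fun _ : Unit => A)) .fst) .snd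
        (.const 0)).not
      (.map Primrec.succ (.map Primrec.list_length .id))
  · ext Y
    simp only [Set.mem_ofPred_eq, paths, T, joinSeg_initSeg, length_initSeg]
    constructor
    · intro h m n _ hc
      exact (key Y n).1 ⟨_, hc⟩ (h n)
    · intro h n
      by_contra hn
      obtain ⟨m, hm⟩ := (key Y n).2 hn
      exact h (max m n) n (by omega) (hm.mono (initSeg_prefix _ (by omega)))

theorem continuousOn_of_uc {P : Set (ℕ → ℕ)} {B : ℕ → ℕ} {F : (ℕ → ℕ) → ℕ → ℕ}
    (h : UC (fun X : P => oplus X B) fun X => F X) : ContinuousOn F P := by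
  obtain ⟨c, hc⟩ := h
  obtain ⟨e, rfl⟩ := ofNat_surjective c
  have hc' (X : ℕ → ℕ) (hX : X ∈ P) (k v : ℕ) :
      F X k = v ↔ ∃ n, ConvTo e (initSeg (oplus X B) n) k v := by
    have := hc ⟨X, hX⟩ k
    simp only [encode_nat] at this
    rw [← mem_evalo_iff, this, Part.mem_some_iff, eq_comm]
  refine continuousOn_pi.2 fun k X hX => ?_
  obtain ⟨n, hn⟩ := (hc' X hX k _).1 rfl
  have hev : ∀ᶠ Z in nhdsWithin X P, ∀ i ∈ Finset.range n, Z i = X i := by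
    rw [Filter.eventually_all_finset]
    intro i _
    have : Filter.Tendsto (fun Z : ℕ → ℕ => Z i) (nhdsWithin X P) (pure (X i)) := by
      rw [← nhds_discrete ℕ]
      exact ((continuous_apply i).tendsto X).mono_left nhdsWithin_le_nhds
    exact Filter.tendsto_pure.1 this
  unfold ContinuousWithinAt
  rw [nhds_discrete ℕ, Filter.tendsto_pure]
  filter_upwards [hev, self_mem_nhdsWithin] with Z hZ hZP
  refine (hc' Z hZP k _).2 ⟨n, ?_⟩
  rwa [initSeg_congr (Y := oplus X B)]
  intro i hi
  simp only [oplus, hZ (i / 2) (Finset.mem_range.2 (by omega))]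

theorem encode_le_of_sublist {σ τ : Str} (h : σ.Sublist τ) : encode σ ≤ encode τ := by
  induction h with
  | slnil => exact le_rfl
  | cons a _ ih =>
    rw [encode_list_cons]
    exact ih.trans ((Nat.right_le_pair _ _).trans (Nat.le_succ _))
  | cons_cons a _ ih =>
    rw [encode_list_cons, encode_list_cons]
    exact Nat.succ_le_succ ((StrictMono.monotone fun _ _ h => Nat.pair_lt_pair_right _ h) ih)

end classes

theorem exists_settled (A : ℕ → ℕ) (e : ℕ) :
    ∃ m, Conv e (initSeg A m) e ∨ ¬ ∃ n, Conv e (initSeg A n) e := by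
  by_cases h : ∃ n, Conv e (initSeg A n) e
  · exact h.imp fun m => Or.inl
  · exact ⟨0, .inr h⟩

/-- The function assigning to `e` one plus the least length of an initial segment of `A` that
makes the `e`-th machine halt on `e`, and `0` if there is none. -/
noncomputable def modulus (A : ℕ → ℕ) (e : ℕ) : ℕ :=
  if ∃ n, Conv e (initSeg A n) e then Nat.find (exists_settled A e) + 1 else 0

theorem jump_eq_modulus (A : ℕ → ℕ) (e : ℕ) : jump A e = if modulus A e = 0 then 0 else 1 := by
  unfold jump modulus
  rw [dom_evalo_iff]
  split_ifs <;> simp_all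

theorem ud_conv_initSeg {I : Type*} {O : I → ℕ → ℕ} {A : I → ℕ → ℕ} (hA : UC O A) :
    UD O fun i (q : ℕ × ℕ) => Conv q.1 (initSeg (A i) q.2) q.1 :=
  .conv .fst (UC.initSeg (X := fun i _ => A i) (hA.comp .snd) .snd) .fst

theorem uc_modulus {I : Type*} (A : I → ℕ → ℕ) :
    UC (fun i => jump (A i)) fun i => modulus (A i) := by
  have h := ud_conv_initSeg (UC.oracle (O := A))
  refine .ite h.query (.map Primrec.succ (UC.find (p := fun i q =>
    Conv q.1 (initSeg (A i) q.2) q.1 ∨ ¬ ∃ n, Conv q.1 (initSeg (A i) n) q.1)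
    (h.to_jump.or (h.query.comp .fst).not) fun i a => ?_)) (.const 0)
  exact ⟨Nat.find_spec (exists_settled (A i) a), fun m => Nat.find_min (exists_settled (A i) a)⟩

theorem eq_modulus_iff {A M : ℕ → ℕ} : M = modulus A ↔ ∀ e s,
    (M e = 0 → ¬ Conv e (initSeg A s) e) ∧
    (M e = s + 1 → Conv e (initSeg A s) e ∧ ∀ t < s, ¬ Conv e (initSeg A t) e) := by
  constructor
  · rintro rfl e s
    unfold modulus
    split_ifs with h
    · refine ⟨by simp, fun hs => ?_⟩
      have hs : Nat.find (exists_settled A e) = s := by omega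
      subst hs
      have hn (t : ℕ) (ht : t < Nat.find (exists_settled A e)) :=
        not_or.1 (Nat.find_min (exists_settled A e) ht)
      exact ⟨(Nat.find_spec (exists_settled A e)).resolve_right (by simpa using h),
        fun t ht => (hn t ht).1⟩
    · exact ⟨fun _ hs => h ⟨s, hs⟩, by simp⟩
  · intro H
    funext e
    unfold modulus
    rcases hM : M e with _ | s
    · rw [if_neg]
      rintro ⟨n, hn⟩
      exact (H e n).1 hM hn
    · obtain ⟨h1, h2⟩ := (H e s).2 hM
      rw [if_pos ⟨s, h1⟩, eq_comm, Nat.add_right_cancel_iff, Nat.find_eq_iff]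
      refine ⟨.inl h1, fun t ht h => ?_⟩
      exact h.elim (h2 t ht) fun h => h ⟨s, h1⟩

theorem isPi01In_image_oplus_modulus {A : ℕ → ℕ} {P : Set (ℕ → ℕ)} (hP : IsPi01In (jump A) P) :
    IsPi01In A ((fun X => oplus X (modulus A)) '' P) := by
  obtain ⟨T, hT, ⟨c, hc⟩, rfl⟩ := hP
  obtain ⟨e, rfl⟩ := ofNat_surjective c
  have hT' (σ : Str) : σ ∈ T ↔ ∀ m, ¬ ConvTo e (initSeg (jump A) m) (encode σ) 0 := by
    rw [← not_exists, ← mem_evalo_iff, hc, Part.mem_some_iff, chi]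
    split_ifs with h <;> simp [h]
  let X (Z : ℕ → ℕ) (n : ℕ) := Z (2 * n)
  let M (Z : ℕ → ℕ) (n : ℕ) := Z (2 * n + 1)
  let J (Z : ℕ → ℕ) (n : ℕ) := if M Z n = 0 then 0 else 1
  let p (Z : ℕ → ℕ) (q : ℕ × ℕ) : Prop :=
    ((M Z q.1 = 0 → ¬ Conv q.1 (initSeg A q.2) q.1) ∧
      (M Z q.1 = q.2 + 1 → Conv q.1 (initSeg A q.2) q.1 ∧
        ∀ t < q.2, ¬ Conv q.1 (initSeg A t) q.1)) ∧
    ¬ ConvTo e (initSeg (J Z) q.2) (encode (initSeg (X Z) q.1)) 0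
  have hX : UC (fun Z => oplus Z A) X :=
    UC.left.comp (.of_primrec (Primrec.nat_mul.comp (.const 2) .id))
  have hM : UC (fun Z => oplus Z A) M :=
    UC.left.comp (.of_primrec (Primrec.succ.comp (Primrec.nat_mul.comp (.const 2) .id)))
  have hJ : UC (fun Z => oplus Z A) J := .ite (.rel Primrec.eq hM (.const 0)) (.const 0) (.const 1)
  have hE : UD (fun Z => oplus Z A) fun _ (q : ℕ × ℕ) => Conv q.1 (initSeg A q.2) q.1 :=
    ud_conv_initSeg .right
  have hp : UD (fun Z => oplus Z A) p := by
    refine .and (.and (.imp (.rel Primrec.eq (hM.comp .fst) (.const 0)) hE.not)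
      (.imp (.rel Primrec.eq (hM.comp .fst) (.map Primrec.succ .snd)) (.and hE ?_))) ?_
    · exact UD.forall_lt (p := fun _ r => ¬ Conv r.1.1 (initSeg A r.2) r.1.1)
        (hE.comp ((UC.fst.comp .fst).pair .snd)).not .snd
    · exact (UD.convTo (.const e) (UC.initSeg (X := fun Z _ => J Z) (hJ.comp .snd) .snd)
        (.map Primrec.encode (UC.initSeg (X := fun Z _ => X Z) (hX.comp .snd) .fst)) (.const 0)).not
  have hQ : (fun X => oplus X (modulus A)) '' paths T = {Z | ∀ n, p Z (Nat.unpair n)} := by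
    ext Z
    have h1 : (∀ n, p Z (Nat.unpair n)) ↔ ∀ a b, p Z (a, b) := by
      constructor
      · intro h a b
        simpa using h (Nat.pair a b)
      · exact fun h n => h _ _
    have h2 : (∀ a b, p Z (a, b)) ↔ M Z = modulus A ∧ X Z ∈ paths T := by
      simp only [p, forall_and]
      rw [eq_modulus_iff]
      simp only [forall_and]
      refine and_congr_right fun h => ?_
      have hM := eq_modulus_iff.2 fun e s => ⟨h.1 e s, fun hs =>
        ⟨h.2.1 e s hs, h.2.2 e s hs⟩⟩
      have hJ : J Z = jump A := funext fun n => by simp only [J, hM, jump_eq_modulus]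
      simp only [hJ, paths, Set.mem_ofPred_eq, hT']
    rw [Set.mem_ofPred_eq, h1, h2]
    constructor
    · rintro ⟨Y, hY, rfl⟩
      refine ⟨funext fun n => oplus_two_mul_add_one _ _ _, ?_⟩
      rwa [show X (oplus Y (modulus A)) = Y from funext fun n => oplus_two_mul _ _ _]
    · rintro ⟨hM, hX⟩
      refine ⟨X Z, hX, funext fun n => ?_⟩
      simp only [← hM]
      rcases Nat.even_or_odd' n with ⟨k, rfl | rfl⟩
      · exact oplus_two_mul _ _ _
      · exact oplus_two_mul_add_one _ _ _
  rw [hQ]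
  exact isPi01In_of_ud (hp.comp (.of_primrec Primrec.unpair))

/-! ### Chains of strings that decide the jump -/

/-- The string with code `u`. -/
abbrev str (u : ℕ) : Str := ofNat Str u

theorem str_encode (σ : Str) : str (encode σ) = σ := ofNat_encode σ

/-- The candidates for extending `ρ` to a string forcing the `k`-th machine to halt on `k`, among
the strings whose code satisfies `v`. -/
def Cand (A : ℕ → ℕ) (v : ℕ → Prop) (k : ℕ) (ρ : Str) (u : ℕ) : Prop :=
  v u ∧ ρ <+: str u ∧ Conv k (joinSeg A (str u)) k

/-- Extend `ρ` to the first candidate, followed by a marker bounding its code, if there is one. -/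
noncomputable def extend (A : ℕ → ℕ) (v : ℕ → Prop) (k : ℕ) (ρ : Str) : Str :=
  if h : ∃ u, Cand A v k ρ u then str (Nat.find h) ++ [Nat.find h + 1] else ρ

/-- The chain of strings alternating between the values of `x` and extensions to candidates. -/
noncomputable def chain (A : ℕ → ℕ) (v : ℕ → Prop) (x : ℕ → ℕ) : ℕ → Str
  | 0 => []
  | k + 1 => extend A v k (chain A v x k ++ [x k])

/-- `ζ` is extended by the chain along a string in `T` with code at most `t`. -/
def Check (A : ℕ → ℕ) (T : Set Str) (v : ℕ → Prop) (t : ℕ) (ζ : Str) : Prop :=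
  ∃ s < t + 1, str s ∈ T ∧ ζ <+: chain A v (fun i => (str s).getD i 0) (str s).length

/-- The predicate with truth table `L`, false beyond the end of the table. -/
def Table (L : List Bool) (u : ℕ) : Prop := L.getD u false = true

/-- The string with code `L.length` is valid, given the table `L` of the validity of strings
with smaller codes. -/
def ValidStep (A : ℕ → ℕ) (T : Set Str) (L : List Bool) : Prop :=
  ∀ t < L.length + 1, ∀ l < (str L.length).length + 1, encode ((str L.length).take l) ≤ t →
    Check A T (Table (L.take t)) t ((str L.length).take l)

/-- The table of the validity of the strings with code below a given bound. -/
noncomputable def validTable (A : ℕ → ℕ) (T : Set Str) : ℕ → List Bool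
  | 0 => []
  | u + 1 => validTable A T u ++ [decide (ValidStep A T (validTable A T u))]

/-- The string with code `u` passes all checks at the stages up to `u`. -/
def Valid (A : ℕ → ℕ) (T : Set Str) (u : ℕ) : Prop := ValidStep A T (validTable A T u)

section chain

variable {A : ℕ → ℕ} {v : ℕ → Prop} {x y : ℕ → ℕ}

theorem extend_of_cand {k : ℕ} {ρ : Str} {u : ℕ} (h : Cand A v k ρ u)
    (hu : ∀ w < u, ¬ Cand A v k ρ w) : extend A v k ρ = str u ++ [u + 1] := by
  have h' : ∃ u, Cand A v k ρ u := ⟨u, h⟩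
  rw [extend, dif_pos h', (Nat.find_eq_iff h').2 ⟨h, hu⟩]

theorem extend_of_not {k : ℕ} {ρ : Str} (h : ¬ ∃ u, Cand A v k ρ u) : extend A v k ρ = ρ :=
  dif_neg h

theorem prefix_extend (k : ℕ) (ρ : Str) : ρ <+: extend A v k ρ := by
  unfold extend
  split_ifs with h
  · exact (Nat.find_spec h).2.1.trans (List.prefix_append _ _)
  · exact List.prefix_rfl

theorem chain_concat_prefix (k : ℕ) : chain A v x k ++ [x k] <+: chain A v x (k + 1) :=
  prefix_extend _ _

theorem chain_mono {k l : ℕ} (h : k ≤ l) : chain A v x k <+: chain A v x l := by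
  induction h with
  | refl => exact List.prefix_rfl
  | step _ ih => exact ih.trans ((List.prefix_append _ _).trans (chain_concat_prefix _))

theorem le_length_chain (k : ℕ) : k ≤ (chain A v x k).length := by
  induction k with
  | zero => exact Nat.zero_le _
  | succ k ih =>
    have := (chain_concat_prefix (A := A) (v := v) (x := x) k).length_le
    simp only [List.length_append, List.length_singleton] at this
    omega

theorem chain_congr {k : ℕ} (h : ∀ i < k, x i = y i) : chain A v x k = chain A v y k := by
  induction k with
  | zero => rfl
  | succ k ih => rw [chain, chain, ih fun i hi => h i (by omega), h k (by omega)]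

theorem initSeg_sublist_chain (k : ℕ) : (initSeg x k).Sublist (chain A v x k) := by
  induction k with
  | zero => exact List.nil_sublist _
  | succ k ih =>
    rw [initSeg_succ]
    exact (ih.append (List.Sublist.refl _)).trans (chain_concat_prefix k).sublist

theorem eq_of_chain_concat_prefix {k l i : ℕ} (h : chain A v x k ++ [i] <+: chain A v y l) :
    k < l ∧ (∀ j < k, x j = y j) ∧ y k = i := by
  induction k generalizing i with
  | zero =>
    rcases l with _ | l
    · simpa [chain] using h.length_le
    have h' := (chain_concat_prefix (A := A) (v := v) (x := y) 0).trans
      (chain_mono (x := y) (show 0 + 1 ≤ l + 1 by omega))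
    have := List.prefix_of_prefix_length_le h h' (by simp [chain])
    refine ⟨by omega, by simp, ?_⟩
    simpa [chain, eq_comm] using this
  | succ k ih =>
    obtain ⟨hl, hxy, hk⟩ := ih (((chain_concat_prefix k).trans (List.prefix_append _ _)).trans h)
    have hxy' : ∀ j < k + 1, x j = y j := fun j hj => by
      rcases Nat.lt_succ_iff_lt_or_eq.1 hj with hj | rfl
      · exact hxy j hj
      · exact hk.symm
    rw [chain_congr hxy'] at h
    rcases Nat.lt_or_ge (k + 1) l with hl' | hl'
    · have h' := (chain_concat_prefix (A := A) (v := v) (x := y) (k + 1)).trans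
        (chain_mono (x := y) (show k + 1 + 1 ≤ l by omega))
      have := (List.prefix_of_prefix_length_le h h' (by simp)).eq_of_length (by simp)
      refine ⟨hl', hxy', ?_⟩
      simpa [eq_comm] using this
    · have h1 := h.length_le
      have h2 := (chain_mono (A := A) (v := v) (x := y) hl').length_le
      simp only [List.length_append, List.length_singleton] at h1
      omega

end chain

/-- `σ` is an initial segment of `Y`. -/
def SegOf (σ : Str) (Y : ℕ → ℕ) : Prop := initSeg Y σ.length = σ

theorem segOf_initSeg (Y : ℕ → ℕ) (n : ℕ) : SegOf (initSeg Y n) Y := by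
  simp [SegOf]

theorem SegOf.of_prefix {σ τ : Str} {Y : ℕ → ℕ} (h : SegOf τ Y) (hσ : σ <+: τ) : SegOf σ Y := by
  have hl := hσ.length_le
  rw [← h, prefix_initSeg_iff hl] at hσ
  exact hσ.symm

theorem SegOf.isPrefix {σ τ : Str} {Y : ℕ → ℕ} (hσ : SegOf σ Y) (hτ : SegOf τ Y)
    (h : σ.length ≤ τ.length) : σ <+: τ := by
  rw [← hσ, ← hτ]
  exact initSeg_prefix _ h

theorem SegOf.getD {σ : Str} {Y : ℕ → ℕ} (h : SegOf σ Y) {i : ℕ} (hi : i < σ.length) :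
    σ.getD i 0 = Y i := by
  rw [← h, getD_initSeg hi]

theorem SegOf.concat {σ : Str} {Y : ℕ → ℕ} (h : SegOf σ Y) : SegOf (σ ++ [Y σ.length]) Y := by
  unfold SegOf at h ⊢
  rw [List.length_append, List.length_singleton, initSeg_succ, h]

/-- The point of Baire space that is the union of the chain along `x`. -/
noncomputable def chainLimit (A : ℕ → ℕ) (v : ℕ → Prop) (x : ℕ → ℕ) (n : ℕ) : ℕ :=
  (chain A v x (n + 1)).getD n 0

theorem segOf_chain (A : ℕ → ℕ) (v : ℕ → Prop) (x : ℕ → ℕ) (k : ℕ) :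
    SegOf (chain A v x k) (chainLimit A v x) := by
  have h (i l : ℕ) (hi : i < (chain A v x l).length) :
      (chain A v x l).getD i 0 = chainLimit A v x i := by
    have hi' : i < (chain A v x (i + 1)).length := le_length_chain _
    unfold chainLimit
    rw [List.getD_eq_getElem?_getD, List.getD_eq_getElem?_getD]
    rcases le_total l (i + 1) with hl | hl
    · obtain ⟨γ, hγ⟩ := chain_mono (A := A) (v := v) (x := x) hl
      rw [← hγ, List.getElem?_append_left hi]
    · obtain ⟨γ, hγ⟩ := chain_mono (A := A) (v := v) (x := x) hl
      rw [← hγ, List.getElem?_append_left hi']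
  exact (initSeg_congr fun i hi => (h i k hi).symm).trans (initSeg_getD _)

/-- Read off from `Y` the chain whose union it might be. -/
noncomputable def decodeChain (A : ℕ → ℕ) (v : ℕ → Prop) (Y : ℕ → ℕ) : ℕ → Str
  | 0 => []
  | k + 1 => extend A v k (decodeChain A v Y k ++ [Y (decodeChain A v Y k).length])

/-- Read off from `Y` the point along which it might be the union of the chain. -/
noncomputable def decodePoint (A : ℕ → ℕ) (v : ℕ → Prop) (Y : ℕ → ℕ) (k : ℕ) : ℕ :=
  Y (decodeChain A v Y k).length

theorem chain_decode (A : ℕ → ℕ) (v : ℕ → Prop) (Y : ℕ → ℕ) (k : ℕ) :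
    chain A v (decodePoint A v Y) k = decodeChain A v Y k := by
  induction k with
  | zero => rfl
  | succ k ih => rw [chain, decodeChain, ih, decodePoint]

theorem decode_chainLimit (A : ℕ → ℕ) (v : ℕ → Prop) (x : ℕ → ℕ) :
    decodePoint A v (chainLimit A v x) = x := by
  have key (k : ℕ) : x k = chainLimit A v x (chain A v x k).length := by
    have h := ((segOf_chain A v x (k + 1)).of_prefix (chain_concat_prefix k)).getD
      (i := (chain A v x k).length) (by simp)
    rw [← h]
    simp
  have h (k : ℕ) : decodeChain A v (chainLimit A v x) k = chain A v x k := by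
    induction k with
    | zero => rfl
    | succ k ih => rw [chain, decodeChain, ih, ← key]
  funext k
  rw [decodePoint, h, ← key]

section valid

variable {A : ℕ → ℕ} {T : Set Str}

theorem length_validTable (u : ℕ) : (validTable A T u).length = u := by
  induction u with
  | zero => rfl
  | succ u ih => simp [validTable, ih]

theorem validTable_take {t u : ℕ} (h : t ≤ u) : (validTable A T u).take t = validTable A T t := by
  induction h with
  | refl => exact List.take_of_length_le (length_validTable t).le
  | @step u h ih =>
    rw [validTable, List.take_append_of_le_length (by rwa [length_validTable]), ih]

theorem table_validTable (t : ℕ) :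
    Table (validTable A T t) = fun u => u < t ∧ Valid A T u := by
  funext u
  refine propext ?_
  unfold Table
  induction t with
  | zero => simp [validTable]
  | succ t ih =>
    rcases lt_trichotomy u t with h | rfl | h
    · rw [validTable, List.getD_append _ _ _ _ (by rwa [length_validTable]), ih]
      simp [h, h.trans (Nat.lt_succ_self t)]
    · rw [validTable, List.getD_append_right _ _ _ _ (by rw [length_validTable]),
        length_validTable]
      simp [Valid]
    · rw [List.getD_eq_default _ _ (by rw [length_validTable]; omega)]
      simp
      omega

/-- The validity predicate restricted to codes below `t`. -/
def ValidBelow (A : ℕ → ℕ) (T : Set Str) (t u : ℕ) : Prop := u < t ∧ Valid A T u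

theorem valid_iff {u : ℕ} : Valid A T u ↔ ∀ t ≤ u, ∀ l ≤ (str u).length,
    encode ((str u).take l) ≤ t → Check A T (ValidBelow A T t) t ((str u).take l) := by
  unfold Valid ValidStep
  rw [length_validTable]
  simp only [Nat.lt_succ_iff]
  refine forall₂_congr fun t ht => ?_
  rw [validTable_take ht, table_validTable]
  rfl

/-- The closed set of points all of whose initial segments pass all checks. -/
def forcedSet (A : ℕ → ℕ) (T : Set Str) : Set (ℕ → ℕ) :=
  {Y | ∀ t l, encode (initSeg Y l) ≤ t → Check A T (ValidBelow A T t) t (initSeg Y l)}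

theorem exists_chain_stable (x : ℕ → ℕ) (k : ℕ) : ∃ t₀, ∀ t ≥ t₀, ∀ j ≤ k,
    chain A (ValidBelow A T t) x j = chain A (Valid A T) x j := by
  induction k with
  | zero =>
    refine ⟨0, fun t _ j hj => ?_⟩
    obtain rfl : j = 0 := by omega
    rfl
  | succ k ih =>
    obtain ⟨t₀, ht₀⟩ := ih
    have : ∃ t₁, ∀ t ≥ t₁, ∀ ρ, ρ = chain A (Valid A T) x k ++ [x k] →
        extend A (ValidBelow A T t) k ρ = extend A (Valid A T) k ρ := by
      by_cases h : ∃ u, Cand A (Valid A T) k (chain A (Valid A T) x k ++ [x k]) u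
      · refine ⟨Nat.find h + 1, fun t ht ρ hρ => ?_⟩
        subst hρ
        rw [extend_of_cand (Nat.find_spec h) fun w => Nat.find_min h]
        refine extend_of_cand ⟨⟨ht, (Nat.find_spec h).1⟩, (Nat.find_spec h).2⟩ fun w hw hc => ?_
        exact Nat.find_min h hw ⟨hc.1.2, hc.2⟩
      · refine ⟨0, fun t _ ρ hρ => ?_⟩
        subst hρ
        rw [extend_of_not h, extend_of_not]
        exact fun ⟨u, hu⟩ => h ⟨u, hu.1.2, hu.2⟩
    obtain ⟨t₁, ht₁⟩ := this
    refine ⟨max t₀ t₁, fun t ht j hj => ?_⟩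
    rcases Nat.le_succ_iff.1 hj with hj | rfl
    · exact ht₀ t (le_trans (le_max_left _ _) ht) j hj
    · rw [chain, chain, ht₀ t (le_trans (le_max_left _ _) ht) k le_rfl]
      exact ht₁ t (le_trans (le_max_right _ _) ht) _ rfl

theorem lt_encode_of_mem {σ : Str} {a : ℕ} (h : a ∈ σ) : a < encode σ := by
  refine lt_of_lt_of_le ?_ (encode_le_of_sublist (List.singleton_sublist.2 h))
  rw [encode_list_cons]
  exact Nat.lt_succ_of_le (Nat.left_le_pair _ _)

theorem initSeg_sublist_of_minimal {v : ℕ → Prop} {x : ℕ → ℕ} {σ : Str} {k : ℕ}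
    (hk : σ <+: chain A v x k) (hmin : ∀ j < k, ¬ σ <+: chain A v x j) :
    (initSeg x k).Sublist σ := by
  rcases k with _ | k
  · exact List.nil_sublist _
  · rw [initSeg_succ]
    refine ((initSeg_sublist_chain (A := A) (v := v) k).append (List.Sublist.refl _)).trans ?_
    rcases List.prefix_or_prefix_of_prefix hk (chain_concat_prefix k) with h | h
    · rcases List.prefix_concat_iff.1 h with h | h
      · rw [h]
      · exact absurd h (hmin k (by omega))
    · exact h.sublist

theorem chainLimit_mem_forcedSet {X : ℕ → ℕ} (hX : X ∈ paths T) :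
    chainLimit A (Valid A T) X ∈ forcedSet A T := by
  intro t l htl
  set Y := chainLimit A (Valid A T) X with hY
  by_cases h : ∃ k, initSeg Y l <+: chain A (ValidBelow A T t) X k
  · have hs := initSeg_sublist_of_minimal (Nat.find_spec h) fun j => Nat.find_min h
    refine ⟨encode (initSeg X (Nat.find h)), ?_, ?_, ?_⟩
    · exact Nat.lt_succ_of_le ((encode_le_of_sublist hs).trans htl)
    · rw [str_encode]
      exact hX _
    · rw [str_encode, length_initSeg, chain_congr fun i hi => getD_initSeg hi]
      exact Nat.find_spec h
  · have hl : ∃ j, chain A (ValidBelow A T t) X j ≠ chain A (Valid A T) X j := by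
      refine ⟨l, fun hl => h ⟨l, ?_⟩⟩
      rw [hl]
      exact (segOf_initSeg Y l).isPrefix (segOf_chain _ _ _ _) (by simpa using le_length_chain l)
    have hne := Nat.find_spec hl
    rcases hj : Nat.find hl with _ | k
    · rw [hj] at hne
      exact absurd rfl hne
    have hk := not_not.1 (Nat.find_min hl (show k < Nat.find hl by omega))
    rw [hj, chain, chain, hk] at hne
    have hc : ∃ u, Cand A (Valid A T) k (chain A (Valid A T) X k ++ [X k]) u := by
      by_contra hc
      rw [extend_of_not hc, extend_of_not] at hne
      · exact hne rfl
      · exact fun ⟨u, hu⟩ => hc ⟨u, hu.1.2, hu.2⟩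
    obtain ⟨u, hu, hmin⟩ : ∃ u, Cand A (Valid A T) k (chain A (Valid A T) X k ++ [X k]) u ∧
        ∀ w < u, ¬ Cand A (Valid A T) k (chain A (Valid A T) X k ++ [X k]) w :=
      ⟨Nat.find hc, Nat.find_spec hc, fun w => Nat.find_min hc⟩
    have htu : t ≤ u := by
      by_contra htu
      refine hne ?_
      rw [extend_of_cand hu hmin]
      exact extend_of_cand ⟨⟨by omega, hu.1⟩, hu.2⟩ fun w hw hc => hmin w hw ⟨hc.1.2, hc.2⟩
    have hseg : SegOf (str u ++ [u + 1]) Y := by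
      rw [← extend_of_cand hu hmin]
      exact segOf_chain A (Valid A T) X (k + 1)
    have hlu : l ≤ (str u).length := by
      by_contra hlu
      have := hseg.isPrefix (segOf_initSeg Y l) (by simp; omega)
      have := lt_encode_of_mem (this.subset (List.mem_append_right _ (List.mem_singleton_self _)))
      omega
    have htake : initSeg Y l = (str u).take l := by
      rw [← hseg.of_prefix (List.prefix_append _ _), initSeg_take, min_eq_left hlu]
    rw [htake] at htl ⊢
    exact valid_iff.1 hu.1 t htu l hlu htl

theorem decode_mem_paths {Y : ℕ → ℕ} (hT : IsTree T) (hY : Y ∈ forcedSet A T) :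
    decodePoint A (Valid A T) Y ∈ paths T ∧
      chainLimit A (Valid A T) (decodePoint A (Valid A T) Y) = Y := by
  set X := decodePoint A (Valid A T) Y with hX
  have step (k : ℕ) (hk : SegOf (chain A (Valid A T) X k) Y) :
      initSeg X (k + 1) ∈ T ∧ SegOf (chain A (Valid A T) X (k + 1)) Y := by
    have hXk : X k = Y (chain A (Valid A T) X k).length := by rw [hX, chain_decode, decodePoint]
    obtain ⟨t₀, ht₀⟩ := exists_chain_stable (A := A) (T := T) X (k + 1)
    set R := chain A (Valid A T) X (k + 1) with hR
    set t := max t₀ (encode (initSeg Y R.length)) with ht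
    obtain ⟨s, -, hsT, hs⟩ := hY t R.length (le_max_right _ _)
    have hpre : chain A (Valid A T) X k ++ [X k] <+: initSeg Y R.length := by
      refine SegOf.isPrefix (hXk ▸ hk.concat) (segOf_initSeg _ _) ?_
      rw [length_initSeg]
      exact (chain_concat_prefix k).length_le
    have hM := hpre.trans hs
    rw [← ht₀ t (le_max_left _ _) k (by omega)] at hM
    obtain ⟨hlt, hag, hXk'⟩ := eq_of_chain_concat_prefix hM
    have hag' : ∀ j < k + 1, X j = (str s).getD j 0 := fun j hj => by
      rcases Nat.lt_succ_iff_lt_or_eq.1 hj with hj | rfl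
      · exact hag j hj
      · exact hXk'.symm
    constructor
    · rw [initSeg_congr hag']
      refine hT _ _ ?_ hsT
      nth_rw 2 [← initSeg_getD (str s)]
      exact initSeg_prefix _ hlt
    · have hRs : R <+: chain A (ValidBelow A T t) (fun i => (str s).getD i 0) (str s).length := by
        rw [hR, ← ht₀ t (le_max_left _ _) (k + 1) le_rfl, chain_congr hag']
        exact chain_mono hlt
      exact (List.prefix_of_prefix_length_le hs hRs (by simp)).eq_of_length (by simp)
  have hseg (k : ℕ) : SegOf (chain A (Valid A T) X k) Y := by
    induction k with
    | zero => rfl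
    | succ k ih => exact (step k ih).2
  refine ⟨fun n => hT _ _ (initSeg_prefix X (Nat.le_succ n)) (step n (hseg n)).1, ?_⟩
  funext n
  exact (hseg (n + 1)).getD (le_length_chain (n + 1))

theorem image_chainLimit (hT : IsTree T) :
    chainLimit A (Valid A T) '' paths T = forcedSet A T := by
  ext Y
  constructor
  · rintro ⟨X, hX, rfl⟩
    exact chainLimit_mem_forcedSet hX
  · exact fun hY => ⟨_, decode_mem_paths hT hY⟩

theorem conv_iff_exists_cand {X : ℕ → ℕ} (hX : X ∈ paths T) (k : ℕ) :
    (∃ n, Conv k (initSeg (oplus (chainLimit A (Valid A T) X) A) n) k) ↔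
      ∃ u, Cand A (Valid A T) k (chain A (Valid A T) X k ++ [X k]) u := by
  have hYQ := chainLimit_mem_forcedSet (A := A) hX
  have hseg := segOf_chain A (Valid A T) X (k + 1)
  set Y := chainLimit A (Valid A T) X
  constructor
  · rintro ⟨n, hn⟩
    set ρ := chain A (Valid A T) X k ++ [X k] with hρ
    have hρY : SegOf ρ Y := hseg.of_prefix (chain_concat_prefix k)
    refine ⟨encode (initSeg Y (max n ρ.length)), valid_iff.2 ?_, ?_, ?_⟩
    · rw [str_encode]
      intro t _ l hl
      rw [length_initSeg] at hl
      rw [initSeg_take, min_eq_left hl]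
      exact hYQ t l
    · rw [str_encode]
      exact hρY.isPrefix (segOf_initSeg _ _) (by simp)
    · rw [str_encode, joinSeg_initSeg]
      exact hn.mono (initSeg_prefix _ (by omega))
  · intro h
    have hu := Nat.find_spec h
    rw [chain, extend_of_cand hu fun w => Nat.find_min h] at hseg
    refine ⟨2 * (str (Nat.find h)).length, ?_⟩
    rw [← joinSeg_initSeg, hseg.of_prefix (List.prefix_append _ _)]
    exact hu.2.2

end valid

section inversion

variable {I : Type*} {O : I → ℕ → ℕ} {α β γ δ : Type} [Primcodable α] [Primcodable β]
  [Primcodable γ] [Primcodable δ] {A : ℕ → ℕ} {T : Set Str}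

theorem primrec_str : Primrec str := by
  have h : Primrec fun u : ℕ => ((Encodable.decode u : Option Str).getD []) :=
    Primrec.option_getD.comp .decode (.const [])
  exact h.of_eq fun u => by rw [decode_eq_ofNat]; rfl

theorem UD.isPrefix {σ τ : I → α → Str} (hσ : UC O σ) (hτ : UC O τ) :
    UD O fun i a => σ i a <+: τ i a :=
  (UD.rel Primrec.eq hσ (.map₂ (g := fun n (l : Str) => l.take n) Primrec.list_take
    (.map Primrec.list_length hσ) hτ)).of_iff fun _ _ => List.prefix_iff_eq_take.symm

theorem UD.cand {v : I → α → ℕ → Prop} {k u : I → α → ℕ} {ρ : I → α → Str}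
    (hA : UC O fun _ => A) (hv : UD O fun i a => v i a (u i a)) (hk : UC O k) (hρ : UC O ρ)
    (hu : UC O u) : UD O fun i a => Cand A (v i a) (k i a) (ρ i a) (u i a) :=
  have hs : UC O fun i a => str (u i a) := .map primrec_str hu
  hv.and (.and (.isPrefix hρ hs) (.conv hk (.joinSeg hA hs) hk))

theorem UC.extend {v : I → α → ℕ → Prop} {k : I → α → ℕ} {ρ : I → α → Str}
    (hc : UD O fun i (q : α × ℕ) => Cand A (v i q.1) (k i q.1) (ρ i q.1) q.2)
    (he : UD O fun i a => ∃ u, Cand A (v i a) (k i a) (ρ i a) u) (hρ : UC O ρ) :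
    UC O fun i a => extend A (v i a) (k i a) (ρ i a) := by
  have hex (i : I) (a : α) : ∃ m, Cand A (v i a) (k i a) (ρ i a) m ∨
      ¬ ∃ u, Cand A (v i a) (k i a) (ρ i a) u := by
    by_cases h : ∃ u, Cand A (v i a) (k i a) (ρ i a) u
    · exact h.imp fun _ => Or.inl
    · exact ⟨0, .inr h⟩
  have hm : UC O fun i a => Nat.find (hex i a) :=
    UC.find (p := fun i q => Cand A (v i q.1) (k i q.1) (ρ i q.1) q.2 ∨
      ¬ ∃ u, Cand A (v i q.1) (k i q.1) (ρ i q.1) u) (hc.or (he.comp .fst).not)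
      fun i a => ⟨Nat.find_spec (hex i a), fun m => Nat.find_min (hex i a)⟩
  have hs : Primrec fun u : ℕ => str u ++ [u + 1] :=
    Primrec.list_concat.comp primrec_str .succ
  refine (UC.ite he (.map hs hm) hρ).of_eq fun i a => ?_
  split_ifs with h
  · refine (extend_of_cand ((Nat.find_spec (hex i a)).resolve_right (not_not.2 h)) ?_).symm
    exact fun w hw hc => Nat.find_min (hex i a) hw (.inl hc)
  · exact (extend_of_not h).symm

theorem UC.chain {v : I → α → ℕ → Prop} {x : I → α → ℕ → ℕ} {n : I → α → ℕ}
    (hA : UC O fun _ => A) (hv : UD O fun i (q : α × ℕ) => v i q.1 q.2)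
    (he : UD O fun i (q : α × ℕ × Str) => ∃ u, Cand A (v i q.1) q.2.1 q.2.2 u)
    (hx : UC O fun i (q : α × ℕ) => x i q.1 q.2) (hn : UC O n) :
    UC O fun i a => chain A (v i a) (x i a) (n i a) := by
  have hext : UC O fun i (q : α × ℕ × Str) => Harrington.extend A (v i q.1) q.2.1 q.2.2 := by
    refine UC.extend (α := α × ℕ × Str) (v := fun i q => v i q.1) (k := fun _ q => q.2.1)
      (ρ := fun _ q => q.2.2)
      (UD.cand (v := fun i (q : (α × ℕ × Str) × ℕ) => v i q.1.1) (k := fun _ q => q.1.2.1)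
        (ρ := fun _ q => q.1.2.2) (u := fun _ q => q.2) hA ?_ ?_ ?_ .snd) he (UC.snd.comp .snd)
    · exact hv.comp ((UC.fst.comp .fst).pair .snd)
    · exact UC.fst.comp (UC.snd.comp .fst)
    · exact UC.snd.comp (UC.snd.comp .fst)
  have h := UC.nat_rec (O := O) (α := α) (β := Str) (f := fun _ _ => [])
    (g := fun i (q : α × ℕ × Str) =>
      Harrington.extend A (v i q.1) q.2.1 (q.2.2 ++ [x i q.1 q.2.1])) (.const _)
    (hext.comp (UC.fst.pair ((UC.fst.comp .snd).pair
      (.map₂ (g := fun (l : Str) (b : ℕ) => l ++ [b]) Primrec.list_concat (UC.snd.comp .snd)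
        (hx.comp (UC.fst.pair (UC.fst.comp .snd)))))))
  refine (h.comp (UC.id.pair hn)).of_eq fun i a => ?_
  simp only
  induction n i a with
  | zero => rfl
  | succ n ih => rw [Harrington.chain, ← ih]

theorem ud_table : UD O fun _ (q : List Bool × ℕ) => Table q.1 q.2 :=
  (UD.rel Primrec.eq (UC.of_primrec (g := fun q : List Bool × ℕ => q.1.getD q.2 false)
    (Primrec.list_getD false)) (.const true)).of_iff fun _ _ => Iff.rfl

theorem UD.check {L : I → α → List Bool} {t : I → α → ℕ} {ζ : I → α → Str}
    (hA : UC O fun _ => A) (hT : UD O fun _ σ => σ ∈ T) (hL : UC O L) (ht : UC O t)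
    (hζ : UC O ζ) : UD O fun i a => Check A T (Table (L i a)) (t i a) (ζ i a) := by
  have hs : UC O fun _ (q : α × ℕ) => str q.2 := .map primrec_str .snd
  refine UD.exists_lt (p := fun i q => str q.2 ∈ T ∧ ζ i q.1 <+:
    chain A (Table (L i q.1)) (fun j => (str q.2).getD j 0) (str q.2).length)
    (.and (hT.comp hs) (.isPrefix (hζ.comp .fst) (UC.chain (v := fun i q => Table (L i q.1))
      (x := fun _ q j => (str q.2).getD j 0) hA ?_ ?_ ?_ (.map Primrec.list_length hs))))
    (.map Primrec.succ ht)
  · exact ud_table.comp ((hL.comp (UC.fst.comp .fst)).pair .snd)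
  · have hlt : UD O fun i (q : (α × ℕ) × ℕ × Str) => ∃ u < (L i q.1.1).length,
        Cand A (Table (L i q.1.1)) q.2.1 q.2.2 u := by
      refine UD.exists_lt (p := fun i (r : ((α × ℕ) × ℕ × Str) × ℕ) =>
        Cand A (Table (L i r.1.1.1)) r.1.2.1 r.1.2.2 r.2)
        (UD.cand (v := fun i (r : ((α × ℕ) × ℕ × Str) × ℕ) => Table (L i r.1.1.1))
          (k := fun _ r => r.1.2.1) (ρ := fun _ r => r.1.2.2) (u := fun _ r => r.2) hA
          (ud_table.comp ((hL.comp (UC.fst.comp (UC.fst.comp .fst))).pair .snd))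
          (UC.fst.comp (UC.snd.comp .fst)) (UC.snd.comp (UC.snd.comp .fst)) .snd)
        (.map Primrec.list_length (hL.comp (UC.fst.comp .fst)))
    refine hlt.of_iff fun i q => exists_congr fun u => and_iff_right_of_imp fun hu => ?_
    by_contra hlu
    have := hu.1
    rw [Table, List.getD_eq_default _ _ (not_lt.1 hlu)] at this
    exact Bool.false_ne_true this
  · exact .map₂ (g := fun (l : Str) j => l.getD j 0) (Primrec.list_getD 0) (hs.comp .fst) .snd

theorem ud_validStep (hA : UC O fun _ => A) (hT : UD O fun _ σ => σ ∈ T) :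
    UD O fun _ L => ValidStep A T L := by
  have hs : UC O fun _ (L : List Bool) => str L.length :=
    .of_primrec (primrec_str.comp .list_length)
  have hζ : UC O fun _ (q : (List Bool × ℕ) × ℕ) => (str q.1.1.length).take q.2 :=
    .map₂ (g := fun n (l : Str) => l.take n) Primrec.list_take .snd (hs.comp (UC.fst.comp .fst))
  refine UD.forall_lt (p := fun _ (q : List Bool × ℕ) =>
    ∀ l < (str q.1.length).length + 1, encode ((str q.1.length).take l) ≤ q.2 →
      Check A T (Table (q.1.take q.2)) q.2 ((str q.1.length).take l))
    (UD.forall_lt (p := fun _ (r : (List Bool × ℕ) × ℕ) =>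
      encode ((str r.1.1.length).take r.2) ≤ r.1.2 →
        Check A T (Table (r.1.1.take r.1.2)) r.1.2 ((str r.1.1.length).take r.2))
      (.imp (.rel Primrec.nat_le (.map Primrec.encode hζ) (UC.snd.comp .fst))
        (.check hA hT ?_ (UC.snd.comp .fst) hζ))
      (.map Primrec.succ (.map Primrec.list_length (hs.comp .fst))))
    (.map Primrec.succ (.of_primrec .list_length))
  exact .map₂ (g := fun n (l : List Bool) => l.take n) Primrec.list_take (UC.snd.comp .fst)
    (UC.fst.comp .fst)

theorem uc_validTable (hA : UC O fun _ => A) (hT : UD O fun _ σ => σ ∈ T) :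
    UC O fun _ t => validTable A T t := by
  have h := UC.nat_rec (O := O) (α := Unit) (β := List Bool) (f := fun _ _ => [])
    (g := fun _ q => q.2.2 ++ [decide (ValidStep A T q.2.2)]) (.const _)
    (.map₂ (g := fun (l : List Bool) b => l ++ [b]) Primrec.list_concat (UC.snd.comp .snd)
      (UC.decide ((ud_validStep hA hT).comp (UC.snd.comp .snd))))
  refine (h.comp ((UC.const ()).pair .id)).of_eq fun i t => ?_
  simp only
  induction t with
  | zero => rfl
  | succ t ih => rw [validTable, ← ih]

theorem isPi01In_forcedSet (hT : SetRecIn A T) : IsPi01In A (forcedSet A T) := by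
  have hA : UC (fun Y => oplus Y A) fun _ => A := .right
  have hT : UD (fun Y => oplus Y A) fun _ σ => σ ∈ T := hT.ud.lift hA
  have hY : UC (fun Y => oplus Y A) fun Y (q : ℕ × ℕ) => initSeg Y q.2 :=
    UC.initSeg (X := fun Y _ => Y) (UC.comp .left .snd) .snd
  have h : UD (fun Y => oplus Y A) fun Y (q : ℕ × ℕ) => encode (initSeg Y q.2) ≤ q.1 →
      Check A T (Table (validTable A T q.1)) q.1 (initSeg Y q.2) :=
    .imp (.rel Primrec.nat_le (.map Primrec.encode hY) .fst)
      (.check hA hT ((uc_validTable hA hT).comp .fst) .fst hY)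
  convert isPi01In_of_ud (h.comp (.of_primrec Primrec.unpair)) using 1
  ext Y
  constructor
  · intro hY n hn
    rw [table_validTable]
    exact hY _ _ hn
  · intro hY t l hl
    have := hY (Nat.pair t l)
    rw [Nat.unpair_pair, table_validTable] at this
    exact this hl

theorem ud_valid (hA : UC O fun _ => A) (hT : UD O fun _ σ => σ ∈ T) :
    UD O fun _ u => Valid A T u :=
  (ud_validStep hA hT).comp (uc_validTable hA hT)

theorem ud_exists_cand (hT : SetRecIn A T) (hA : UC O fun _ => jump A) :
    UD O fun _ (q : ℕ × Str) => ∃ u, Cand A (Valid A T) q.1 q.2 u := by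
  have h : UD (fun _ : Unit => A) fun _ (r : (ℕ × Str) × ℕ) =>
      Cand A (Valid A T) r.1.1 r.1.2 r.2 :=
    UD.cand (v := fun _ _ => Valid A T) .oracle ((ud_valid .oracle hT.ud).comp .snd)
      (UC.fst.comp .fst) (UC.snd.comp .fst) .snd
  exact h.query.lift hA

theorem uc_extend_valid (hT : SetRecIn A T) (hA : UC O fun _ => jump A) :
    UC O fun _ (q : ℕ × Str) => extend A (Valid A T) q.1 q.2 := by
  have hA' : UC O fun _ => A := UC.oracle_jump.lift hA
  exact UC.extend (v := fun _ _ => Valid A T) (UD.cand (v := fun _ _ => Valid A T) hA'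
    ((ud_valid hA' (hT.ud.lift hA')).comp .snd) (UC.fst.comp .fst) (UC.snd.comp .fst) .snd)
    (ud_exists_cand hT hA) .snd

theorem uc_chain_valid {X : I → ℕ → ℕ} (hT : SetRecIn A T) (hA : UC O fun _ => jump A)
    (hX : UC O X) : UC O fun i => chain A (Valid A T) (X i) := by
  have hA' : UC O fun _ => A := UC.oracle_jump.lift hA
  exact UC.chain (α := ℕ) (v := fun _ _ => Valid A T) (x := fun i _ => X i) hA'
    ((ud_valid hA' (hT.ud.lift hA')).comp .snd) ((ud_exists_cand hT hA).comp .snd)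
    (hX.comp .snd) .id

theorem uc_chainLimit {X : I → ℕ → ℕ} (hT : SetRecIn A T) (hA : UC O fun _ => jump A)
    (hX : UC O X) : UC O fun i => chainLimit A (Valid A T) (X i) :=
  .map₂ (g := fun (l : Str) n => l.getD n 0) (Primrec.list_getD 0)
    ((uc_chain_valid hT hA hX).comp (.of_primrec Primrec.succ)) .id

theorem uc_decodePoint {Y : I → ℕ → ℕ} (hT : SetRecIn A T) (hA : UC O fun _ => jump A)
    (hY : UC O Y) : UC O fun i => decodePoint A (Valid A T) (Y i) := by
  have h := UC.nat_rec (O := O) (α := Unit) (β := Str) (f := fun _ _ => [])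
    (g := fun i q => extend A (Valid A T) q.2.1 (q.2.2 ++ [Y i q.2.2.length])) (.const _)
    ((uc_extend_valid hT hA).comp ((UC.fst.comp .snd).pair
      (.map₂ (g := fun (l : Str) (b : ℕ) => l ++ [b]) Primrec.list_concat (UC.snd.comp .snd)
        (hY.comp (.map Primrec.list_length (UC.snd.comp .snd))))))
  have hd : UC O fun i => decodeChain A (Valid A T) (Y i) := by
    refine (h.comp ((UC.const ()).pair .id)).of_eq fun i t => ?_
    simp only
    induction t with
    | zero => rfl
    | succ t ih => rw [decodeChain, ← ih]
  exact hY.comp (.map Primrec.list_length hd)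

theorem uc_jump_chainLimit {P : Set (ℕ → ℕ)} (hP : P = paths T) (hT : SetRecIn A T) :
    UC (fun X : P => oplus X (jump A))
      fun X : P => jump (oplus (chainLimit A (Valid A T) X) A) := by
  have hX : UC (fun X : P => oplus X (jump A)) fun X => (X : ℕ → ℕ) := .left
  have hJ : UC (fun X : P => oplus X (jump A)) fun _ => jump A := .right
  have h : UD (fun X : P => oplus X (jump A)) fun X k =>
      ∃ u, Cand A (Valid A T) k (chain A (Valid A T) X k ++ [(X : ℕ → ℕ) k]) u :=
    (ud_exists_cand hT hJ).comp (f := fun (X : P) k =>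
      (k, chain A (Valid A T) X k ++ [(X : ℕ → ℕ) k])) (UC.id.pair
      (.map₂ (g := fun (l : Str) (b : ℕ) => l ++ [b]) Primrec.list_concat
        (uc_chain_valid hT hJ hX) hX))
  refine (UC.ite h (.const 1) (.const 0)).of_eq fun X k => ?_
  have hXT : (X : ℕ → ℕ) ∈ paths T := by
    rw [← hP]
    exact X.2
  unfold jump
  simp only [dom_evalo_iff, conv_iff_exists_cand hXT]

/-- Inversion of a single jump on a closed set. -/
theorem exists_jump_inversion {P : Set (ℕ → ℕ)} (hP : IsPi01In A P) :
    ∃ H : (ℕ → ℕ) → ℕ → ℕ, IsPi01In A (H '' P) ∧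
      UC (fun X : P => oplus X (jump A)) (fun X => H X) ∧
      UC (fun X : P => oplus (H X) (jump A)) (fun X => (X : ℕ → ℕ)) ∧
      UC (fun X : P => oplus X (jump A)) (fun X => jump (oplus (H X) A)) := by
  obtain ⟨T, hT, hrec, hPT⟩ := hP
  refine ⟨chainLimit A (Valid A T), ?_, uc_chainLimit hrec .right .left, ?_,
    uc_jump_chainLimit hPT hrec⟩
  · rw [hPT, image_chainLimit hT]
    exact isPi01In_forcedSet hrec
  · refine (uc_decodePoint hrec .right .left).of_eq fun X => ?_
    rw [decode_chainLimit]
    exact fun _ => rfl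

/-- Inversion of a single jump on a set that is closed relative to the jump. -/
theorem exists_jump_inversion_of_jump {P : Set (ℕ → ℕ)} (hP : IsPi01In (jump A) P) :
    ∃ H : (ℕ → ℕ) → ℕ → ℕ, IsPi01In A (H '' P) ∧
      UC (fun X : P => oplus X (jump A)) (fun X => H X) ∧
      UC (fun X : P => oplus (H X) (jump A)) (fun X => (X : ℕ → ℕ)) ∧
      UC (fun X : P => oplus X (jump A)) (fun X => jump (oplus (H X) A)) := by
  obtain ⟨H, h0, h1, h2, h3⟩ := exists_jump_inversion (isPi01In_image_oplus_modulus hP)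
  let r : P → (fun X => oplus X (modulus A)) '' P := fun X => ⟨_, Set.mem_image_of_mem _ X.2⟩
  have hμ : UC (fun X : P => oplus X (jump A)) fun _ => modulus A :=
    (uc_modulus fun _ : Unit => A).lift .right
  have hr : UC (fun X : P => oplus X (jump A))
      fun X : P => oplus (oplus X (modulus A)) (jump A) := .oplus (.oplus .left hμ) .right
  refine ⟨fun X => H (oplus X (modulus A)), ?_, (h1.reindex r).trans hr, ?_,
    (h3.reindex r).trans hr⟩
  · rwa [Set.image_image] at h0
  · exact (h2.reindex r).of_oplus_left

/-- Iterated jump inversion, with all reductions in uniform form. -/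
theorem exists_jumpIter_inversion (n : ℕ) {P : Set (ℕ → ℕ)}
    (hP : IsPi01In (jumpIter zeroF n) P) :
    ∃ H : (ℕ → ℕ) → ℕ → ℕ, IsPi01 (H '' P) ∧
      UC (fun X : P => oplus X (jumpIter zeroF n)) (fun X => H X) ∧
      UC (fun X : P => oplus (H X) (jumpIter zeroF n)) (fun X => (X : ℕ → ℕ)) ∧
      UC (fun X : P => oplus (H X) (jumpIter zeroF n)) (fun X => jumpIter (H X) n) ∧
      UC (fun X : P => jumpIter (H X) n) (fun X => oplus (H X) (jumpIter zeroF n)) := by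
  induction n generalizing P with
  | zero =>
    have hz : UC (fun X : P => (X : ℕ → ℕ)) fun _ => zeroF := .const 0
    refine ⟨id, ?_, .left, .left, .left, .oplus .oracle hz⟩
    rwa [Set.image_id]
  | succ n ih =>
    set A := jumpIter zeroF n
    obtain ⟨H₁, hQ, h1, h2, h3⟩ := exists_jump_inversion_of_jump hP
    obtain ⟨H₂, hR, k1, k2, k3, k4⟩ := ih hQ
    let r : P → H₁ '' P := fun X => ⟨_, Set.mem_image_of_mem _ X.2⟩
    have hA {J : Type _} {O : J → ℕ → ℕ} (h : UC O fun _ => jump A) : UC O fun _ => A :=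
      (UC.oracle_jump (O := fun _ : Unit => A)).lift h
    have l1 : UC (fun X : P => oplus (H₁ X) A) fun X => H₂ (H₁ X) := k1.reindex r
    have l2 : UC (fun X : P => oplus (H₂ (H₁ X)) A) fun X => H₁ X := k2.reindex r
    have l3 : UC (fun X : P => oplus (H₂ (H₁ X)) A) fun X => jumpIter (H₂ (H₁ X)) n :=
      k3.reindex r
    have l4 : UC (fun X : P => jumpIter (H₂ (H₁ X)) n) fun X => oplus (H₂ (H₁ X)) A :=
      k4.reindex r
    have m1 : UC (fun X : P => oplus X (jump A)) fun X => H₂ (H₁ X) :=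
      l1.trans (.oplus h1 (hA .right))
    have m2 : UC (fun X : P => oplus (H₂ (H₁ X)) (jump A)) fun X => (X : ℕ → ℕ) :=
      h2.trans (.oplus (l2.trans (.oplus .left (hA .right))) .right)
    refine ⟨fun X => H₂ (H₁ X), ?_, m1, m2, ?_, ?_⟩
    · rwa [Set.image_image] at hR
    · have e : UC (fun X : P => oplus (H₁ X) A) fun X => jumpIter (H₂ (H₁ X)) n :=
        l3.trans (.oplus l1 .right)
      exact e.jump.trans (h3.trans (.oplus m2 .right))
    · have e : UC (fun X : P => jumpIter (H₂ (H₁ X)) n) fun _ => A := l4.of_oplus_right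
      exact .oplus l4.of_oplus_left.to_jump e.jump

end inversion

theorem unifEquivOn_of_uc {P : Set (ℕ → ℕ)} {f g : (ℕ → ℕ) → ℕ → ℕ}
    (h : UC (fun X : P => g X) fun X => f X) (h' : UC (fun X : P => f X) fun X => g X) :
    UnifEquivOn P f g := by
  obtain ⟨c, hc⟩ := h
  obtain ⟨d, hd⟩ := h'
  exact ⟨c, d, fun X hX => ⟨hc ⟨X, hX⟩, hd ⟨X, hX⟩⟩⟩

theorem homeoOn_image_of_uc {P : Set (ℕ → ℕ)} {B : ℕ → ℕ} {H : (ℕ → ℕ) → ℕ → ℕ}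
    (h : UC (fun X : P => oplus X B) fun X => H X)
    (h' : UC (fun X : P => oplus (H X) B) fun X => (X : ℕ → ℕ)) : HomeoOn H P (H '' P) := by
  have hinj : Set.InjOn H P := by
    obtain ⟨c, hc⟩ := h'
    intro X hX Z hZ hXZ
    funext n
    have h₁ := hc ⟨X, hX⟩ n
    have h₂ := hc ⟨Z, hZ⟩ n
    simp only [hXZ] at h₁
    exact Part.some_injective (h₁.symm.trans h₂)
  refine ⟨hinj.bijOn_image, continuousOn_of_uc h, Function.invFunOn H P,
    hinj.bijOn_image.invOn_invFunOn, continuousOn_of_uc (B := B) ?_⟩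
  have hH (Y : H '' P) : H (Function.invFunOn H P Y) = Y := Function.invFunOn_eq Y.2
  have := h'.reindex fun Y : H '' P =>
    (⟨Function.invFunOn H P Y, Function.invFunOn_mem Y.2⟩ : P)
  simpa only [hH] using this

end helpers

/-- **Lemma.**  For every `n` and every `Π^{0,0⁽ⁿ⁾}_1` set `Pₙ` there are a `Π⁰₁` set
`P₀` and a homeomorphism `H : Pₙ → P₀` with
`Xₙ ⊕ 0⁽ⁿ⁾ ≡_T H(Xₙ) ⊕ 0⁽ⁿ⁾ ≡_T H(Xₙ)⁽ⁿ⁾` uniformly for all `Xₙ ∈ Pₙ`. -/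
theorem pi01_nth_jump_inversion (n : ℕ) (P : Set (ℕ → ℕ))
    (hP : IsPi01In (jumpIter zeroF n) P) :
    ∃ (P₀ : Set (ℕ → ℕ)) (H : (ℕ → ℕ) → (ℕ → ℕ)), IsPi01 P₀ ∧ HomeoOn H P P₀ ∧
      UnifEquivOn P (fun X => oplus X (jumpIter zeroF n))
        (fun X => oplus (H X) (jumpIter zeroF n)) ∧
      UnifEquivOn P (fun X => oplus (H X) (jumpIter zeroF n))
        (fun X => jumpIter (H X) n) := by
  obtain ⟨H, h0, h1, h2, h3, h4⟩ := exists_jumpIter_inversion n hP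
  exact ⟨H '' P, H, h0, homeoOn_image_of_uc h1 h2,
    unifEquivOn_of_uc (.oplus h2 .right) (.oplus h1 .right), unifEquivOn_of_uc h4 h3⟩

end Harrington
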